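/- arXiv:1312.4468 — 3 statements merged into one kernel-verified Lean document; each statement's English description precedes it below -/
import Mathlib

section
/- (Theorem 1, case ρ₁ = 0.) Let W be a B-DMC with finite output alphabet, ε ∈ [0, 1], x ∈ [0, 1/2]. If the symmetric capacities are ordered, i.e. R(0, BSC_x) ≤ R(0, W) ≤ R(0, BEC_ε), then for every ρ₂ ∈ [0, 3] one has R(ρ₂, BSC_x) ≤ R(ρ₂, W) ≤ R(ρ₂, BEC_ε), and for every ρ₂ ≥ 0 one has E0(ρ₂, BSC_x) ≤ E0(ρ₂, W) ≤ E0(ρ₂, BEC_ε). -/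
/-- A binary-input discrete memoryless channel: a nonempty finite output alphabet `Y`
together with conditional probability mass functions `W0 = W(·|0)` and `W1 = W(·|1)`. -/
structure BDMC where
  Y : Type
  [fin : Fintype Y]
  [ne : Nonempty Y]
  W0 : Y → ℝ
  W1 : Y → ℝ
  W0_nonneg : ∀ y, 0 ≤ W0 y
  W1_nonneg : ∀ y, 0 ≤ W1 y
  sum_W0 : ∑ y, W0 y = 1
  sum_W1 : ∑ y, W1 y = 1

attribute [instance] BDMC.fin BDMC.ne

/-- Gallager's `E₀` function of a B-DMC under the uniform input distribution:
`E₀(ρ, W) = −log ∑_y (½ W(y|0)^{1/(1+ρ)} + ½ W(y|1)^{1/(1+ρ)})^{1+ρ}`. -/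
noncomputable def E0 (ρ : ℝ) (W : BDMC) : ℝ :=
  -Real.log (∑ y, ((1/2) * W.W0 y ^ (1/(1+ρ)) + (1/2) * W.W1 y ^ (1/(1+ρ))) ^ (1+ρ))

/-- `E₀` of the binary erasure channel with erasure probability `ε`:
`E₀(ρ, BEC_ε) = −log(2^{−ρ}(1−ε) + ε)`. -/
noncomputable def E0bec (ρ ε : ℝ) : ℝ := -Real.log ((2:ℝ) ^ (-ρ) * (1-ε) + ε)

/-- `E₀` of the binary symmetric channel with crossover probability `x`:
`E₀(ρ, BSC_x) = −log(2^{−ρ}(x^{1/(1+ρ)} + (1−x)^{1/(1+ρ)})^{1+ρ})`. -/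
noncomputable def E0bsc (ρ x : ℝ) : ℝ :=
  -Real.log ((2:ℝ) ^ (-ρ) * (x ^ (1/(1+ρ)) + (1-x) ^ (1/(1+ρ))) ^ (1+ρ))

/-- `R(ρ, W)`: the derivative of `ρ ↦ E₀(ρ, W)` at `ρ`. -/
noncomputable def RW (ρ : ℝ) (W : BDMC) : ℝ := deriv (fun r => E0 r W) ρ

/-- `R(ρ, BEC_ε)`: the derivative of `ρ ↦ E₀(ρ, BEC_ε)` at `ρ`. -/
noncomputable def Rbec (ρ ε : ℝ) : ℝ := deriv (fun r => E0bec r ε) ρ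

/-- `R(ρ, BSC_x)`: the derivative of `ρ ↦ E₀(ρ, BSC_x)` at `ρ`. -/
noncomputable def Rbsc (ρ x : ℝ) : ℝ := deriv (fun r => E0bsc r x) ρ

open Real Set Filter Topology

/-- The logarithm of the hyperbolic cosine. -/
noncomputable def logCosh (y : ℝ) : ℝ := log (cosh y)

/-- The Jensen gap `y tanh y - log cosh y`. -/
noncomputable def coshGap (y : ℝ) : ℝ := y * (sinh y / cosh y) - logCosh y

/-- The normalized contribution of an output letter to `exp (-E₀)`, as a function of
`r = 1 + ρ` and of `y = t / r`, where `2 t` is the log-likelihood ratio. -/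
noncomputable def coshRatio (r y : ℝ) : ℝ := exp (r * logCosh y - logCosh (r * y))

theorem monotoneOn_Ioi_of_hasDerivAt {f f' : ℝ → ℝ} (hf : ∀ y, 0 < y → HasDerivAt f (f' y) y)
    (hf' : ∀ y, 0 < y → 0 ≤ f' y) : MonotoneOn f (Ioi 0) := by
  refine monotoneOn_of_deriv_nonneg (convex_Ioi 0)
    (fun y hy => (hf y hy).continuousAt.continuousWithinAt) ?_ ?_
  · rw [interior_Ioi]
    exact fun y hy => (hf y hy).differentiableAt.differentiableWithinAt
  · rw [interior_Ioi]
    intro y hy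
    rw [(hf y hy).deriv]
    exact hf' y hy

theorem le_of_hasDerivAt_nonneg {f f' : ℝ → ℝ} {a b : ℝ} (hab : a ≤ b)
    (hc : ContinuousOn f (Icc a b)) (hf : ∀ y ∈ Ioo a b, HasDerivAt f (f' y) y)
    (hf' : ∀ y ∈ Ioo a b, 0 ≤ f' y) : f a ≤ f b := by
  refine monotoneOn_of_deriv_nonneg (convex_Icc a b) hc ?_ ?_ (left_mem_Icc.2 hab)
    (right_mem_Icc.2 hab) hab
  · rw [interior_Icc]
    exact fun y hy => (hf y hy).differentiableAt.differentiableWithinAt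
  · rw [interior_Icc]
    intro y hy
    rw [(hf y hy).deriv]
    exact hf' y hy

/-- If `f' = k h'` with `k` nonnegative and monotone, `f` is an increasing convex function of `h`,
and hence has supporting lines. -/
theorem exists_support {f h k h' : ℝ → ℝ} (hfc : Continuous f) (hhc : Continuous h)
    (hf : ∀ y, 0 < y → HasDerivAt f (k y * h' y) y) (hh : ∀ y, 0 < y → HasDerivAt h (h' y) y)
    (hh' : ∀ y, 0 < y → 0 ≤ h' y) (hk : ∀ y, 0 < y → 0 ≤ k y) (hkm : MonotoneOn k (Ioi 0))
    {a : ℝ} (ha : 0 ≤ a) :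
    ∃ κ, 0 ≤ κ ∧ ∀ y, 0 ≤ y → κ * (h y - h a) ≤ f y - f a := by
  rcases ha.eq_or_lt with rfl | ha
  · refine ⟨0, le_rfl, fun y hy => ?_⟩
    have := le_of_hasDerivAt_nonneg hy hfc.continuousOn (fun z hz => hf z hz.1)
      (fun z hz => mul_nonneg (hk z hz.1) (hh' z hz.1))
    linarith
  · refine ⟨k a, hk a ha, fun y hy => ?_⟩
    rcases le_total a y with hay | hya
    · have := le_of_hasDerivAt_nonneg (f := fun z => f z - k a * h z)
        (f' := fun z => k z * h' z - k a * h' z) hay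
        (by fun_prop) (fun z hz => (hf z (ha.trans hz.1)).sub ((hh z (ha.trans hz.1)).const_mul _))
        (fun z hz => by
          have h1 := hkm ha (ha.trans hz.1) hz.1.le
          have h2 := hh' z (ha.trans hz.1)
          nlinarith)
      linarith
    · have := le_of_hasDerivAt_nonneg (f := fun z => k a * h z - f z)
        (f' := fun z => k a * h' z - k z * h' z) hya
        (by fun_prop) (fun z hz => ((hh z (hy.trans_lt hz.1)).const_mul _).sub
          (hf z (hy.trans_lt hz.1)))
        (fun z hz => by
          have h1 := hkm (hy.trans_lt hz.1) ha hz.2.le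
          have h2 := hh' z (hy.trans_lt hz.1)
          nlinarith)
      linarith

theorem hasDerivAt_sinh_div_cosh (y : ℝ) :
    HasDerivAt (fun y => sinh y / cosh y) (1 / cosh y ^ 2) y := by
  have h := (hasDerivAt_sinh y).div (hasDerivAt_cosh y) (cosh_pos y).ne'
  refine h.congr_deriv ?_
  rw [← cosh_sq_sub_sinh_sq y]; ring

theorem hasDerivAt_logCosh (y : ℝ) : HasDerivAt logCosh (sinh y / cosh y) y :=
  (hasDerivAt_cosh y).log (cosh_pos y).ne'

theorem hasDerivAt_coshGap (y : ℝ) : HasDerivAt coshGap (y / cosh y ^ 2) y := by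
  have h := ((hasDerivAt_id y).mul (hasDerivAt_sinh_div_cosh y)).sub (hasDerivAt_logCosh y)
  refine h.congr_deriv ?_
  simp only [id]; ring

@[fun_prop]
theorem continuous_logCosh : Continuous logCosh :=
  continuous_iff_continuousAt.2 fun y => (hasDerivAt_logCosh y).continuousAt

@[fun_prop]
theorem continuous_coshGap : Continuous coshGap :=
  continuous_iff_continuousAt.2 fun y => (hasDerivAt_coshGap y).continuousAt

@[simp] theorem logCosh_zero : logCosh 0 = 0 := by simp [logCosh]

@[simp] theorem coshGap_zero : coshGap 0 = 0 := by simp [coshGap]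

@[simp] theorem coshRatio_zero (r : ℝ) : coshRatio r 0 = 1 := by simp [coshRatio]

theorem coshRatio_pos (r y : ℝ) : 0 < coshRatio r y := exp_pos _

theorem logCosh_nonneg (y : ℝ) : 0 ≤ logCosh y := log_nonneg (one_le_cosh y)

theorem coshGap_nonneg {y : ℝ} (hy : 0 ≤ y) : 0 ≤ coshGap y := by
  have := le_of_hasDerivAt_nonneg hy continuous_coshGap.continuousOn
    (fun z _ => hasDerivAt_coshGap z)
    (fun z hz => div_nonneg hz.1.le (sq_nonneg _))
  simpa using this

theorem le_sinh_mul_cosh {y : ℝ} (hy : 0 ≤ y) : y ≤ sinh y * cosh y := by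
  have h1 := self_le_sinh_iff.2 hy
  have h2 := one_le_cosh y
  nlinarith

theorem coshGap_le_logCosh {y : ℝ} (hy : 0 ≤ y) : coshGap y ≤ logCosh y := by
  have := le_of_hasDerivAt_nonneg (f := fun z => logCosh z - coshGap z) hy (by fun_prop)
    (fun z _ => (hasDerivAt_logCosh z).sub (hasDerivAt_coshGap z))
    (fun z hz => by
      have h1 := le_sinh_mul_cosh hz.1.le
      have h2 := cosh_pos z
      rw [sub_nonneg, div_le_div_iff₀ (by positivity) h2]
      nlinarith)
  simpa using this

theorem hasDerivAt_coshRatio (r y : ℝ) :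
    HasDerivAt (coshRatio r)
      (coshRatio r y * (r * (sinh y / cosh y) - r * (sinh (r * y) / cosh (r * y)))) y := by
  have h1 : HasDerivAt (fun y => r * y) r y := by
    simpa using (hasDerivAt_id y).const_mul r
  have h2 := ((hasDerivAt_logCosh y).const_mul r).sub
    ((hasDerivAt_logCosh (r * y)).comp y h1)
  refine h2.exp.congr_deriv ?_
  simp only [coshRatio]
  simp only [Pi.sub_apply, Function.comp_apply]
  ring

@[fun_prop]
theorem continuous_coshRatio (r : ℝ) : Continuous (coshRatio r) :=
  continuous_iff_continuousAt.2 fun y => (hasDerivAt_coshRatio r y).continuousAt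

theorem coshRatio_add_one (ρ y : ℝ) :
    coshRatio (ρ + 1) y = exp (ρ * logCosh y) * cosh y / cosh ((ρ + 1) * y) := by
  rw [coshRatio, add_mul, one_mul, exp_sub, exp_add, logCosh, logCosh, exp_log (cosh_pos _),
    exp_log (cosh_pos _)]

theorem hasDerivAt_coshGap_mul (r y : ℝ) :
    HasDerivAt (fun y => coshGap (r * y)) (r ^ 2 * y / cosh (r * y) ^ 2) y := by
  have h1 : HasDerivAt (fun y => r * y) r y := by
    simpa using (hasDerivAt_id y).const_mul r
  refine ((hasDerivAt_coshGap (r * y)).comp y h1).congr_deriv ?_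
  ring

theorem exp_mul_logCosh_mono {ρ : ℝ} (hρ : 0 ≤ ρ) {x y : ℝ} (hx : 0 ≤ x) (hxy : x ≤ y) :
    exp (ρ * logCosh x) ≤ exp (ρ * logCosh y) := by
  have : cosh x ≤ cosh y := cosh_le_cosh.2 (by rwa [abs_of_nonneg hx, abs_of_nonneg (hx.trans hxy)])
  have := log_le_log (cosh_pos x) this
  exact exp_le_exp.2 (mul_le_mul_of_nonneg_left this hρ)

theorem mul_logCosh_le {y : ℝ} (hy : 0 ≤ y) : logCosh y ≤ y * (sinh y / cosh y) := by
  have := coshGap_nonneg hy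
  rw [coshGap] at this
  linarith

theorem sinh_le_mul_cosh {y : ℝ} (hy : 0 ≤ y) : sinh y ≤ y * cosh y := by
  have := le_of_hasDerivAt_nonneg (f := fun z => z * cosh z - sinh z) hy (by fun_prop)
    (fun z _ => ((hasDerivAt_id z).mul (hasDerivAt_cosh z)).sub (hasDerivAt_sinh z))
    (fun z hz => by
      have := mul_nonneg hz.1.le (sinh_nonneg_iff.2 hz.1.le)
      simpa using this)
  simpa using this

/-- The derivative of `-coshRatio` with respect to `coshGap (r y)`. -/
noncomputable def ratioSlope (ρ y : ℝ) : ℝ :=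
  exp (ρ * logCosh y) * (sinh (ρ * y) / y) / (ρ + 1)

theorem ratioSlope_nonneg {ρ y : ℝ} (hρ : 0 ≤ ρ) (hy : 0 ≤ y) : 0 ≤ ratioSlope ρ y := by
  have := sinh_nonneg_iff.2 (mul_nonneg hρ hy)
  unfold ratioSlope
  positivity

theorem ratioSlope_monotoneOn {ρ : ℝ} (hρ : 0 ≤ ρ) : MonotoneOn (ratioSlope ρ) (Ioi 0) := by
  have h1 : MonotoneOn (fun y => sinh (ρ * y) / y) (Ioi 0) := by
    refine monotoneOn_Ioi_of_hasDerivAt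
      (f' := fun y => (cosh (ρ * y) * ρ * y - sinh (ρ * y) * 1) / y ^ 2) (fun y hy => ?_)
      (fun y hy => ?_)
    · have h1 : HasDerivAt (fun y => ρ * y) ρ y := by
        simpa using (hasDerivAt_id y).const_mul ρ
      exact h1.sinh.div (hasDerivAt_id y) hy.ne'
    · have := sinh_le_mul_cosh (mul_nonneg hρ hy.le)
      refine div_nonneg ?_ (sq_nonneg _)
      linarith
  intro x hx y hy hxy
  have h2 := h1 hx hy hxy
  have h3 := exp_mul_logCosh_mono hρ (le_of_lt hx) hxy
  have h4 : 0 ≤ sinh (ρ * x) / x := div_nonneg (sinh_nonneg_iff.2 (mul_nonneg hρ (le_of_lt hx)))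
    (le_of_lt hx)
  unfold ratioSlope
  gcongr

theorem exists_support_coshRatio {ρ : ℝ} (hρ : 0 ≤ ρ) {a : ℝ} (ha : 0 ≤ a) :
    ∃ κ, 0 ≤ κ ∧ ∀ y, 0 ≤ y →
      κ * (coshGap ((ρ + 1) * y) - coshGap ((ρ + 1) * a)) ≤
        coshRatio (ρ + 1) a - coshRatio (ρ + 1) y := by
  obtain ⟨κ, hκ, h⟩ := exists_support (f := fun y => -coshRatio (ρ + 1) y)
    (h := fun y => coshGap ((ρ + 1) * y)) (k := ratioSlope ρ)
    (h' := fun y => (ρ + 1) ^ 2 * y / cosh ((ρ + 1) * y) ^ 2) (by fun_prop) (by fun_prop)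
    (fun y hy => by
      refine (hasDerivAt_coshRatio (ρ + 1) y).neg.congr_deriv ?_
      have hc := cosh_pos y
      have hC := cosh_pos ((ρ + 1) * y)
      have hs : sinh (ρ * y) = sinh ((ρ + 1) * y) * cosh y - cosh ((ρ + 1) * y) * sinh y := by
        rw [← sinh_sub]; ring_nf
      rw [coshRatio_add_one, ratioSlope, hs]
      field_simp
      ring)
    (fun y _ => hasDerivAt_coshGap_mul _ y) (fun y hy => by positivity)
    (fun y hy => ratioSlope_nonneg hρ hy.le) (ratioSlope_monotoneOn hρ) ha
  exact ⟨κ, hκ, fun y hy => by linarith [h y hy]⟩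

/-- The derivative of `coshRatio r y * coshGap y` with respect to `coshGap (r y)`. -/
noncomputable def gapSlope (ρ y : ℝ) : ℝ :=
  exp (ρ * logCosh y) * ((ρ + 1) * (sinh (ρ * y) * (logCosh y / y)) + cosh (ρ * y)
    - ρ * (sinh y / cosh y * sinh (ρ * y))) / (ρ + 1) ^ 2

theorem half_mul_tanh_le {y : ℝ} (hy : 0 < y) : sinh y / cosh y / 2 ≤ logCosh y / y := by
  have := coshGap_le_logCosh hy.le
  rw [coshGap] at this
  rw [le_div_iff₀ hy]
  linarith

theorem gapSlope_nonneg {ρ y : ℝ} (hρ : 0 ≤ ρ) (hρ3 : ρ ≤ 3) (hy : 0 < y) :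
    0 ≤ gapSlope ρ y := by
  refine div_nonneg (mul_nonneg (exp_pos _).le ?_) (sq_nonneg _)
  have hS := sinh_nonneg_iff.2 (mul_nonneg hρ hy.le)
  have hSC := (sinh_lt_cosh (ρ * y)).le
  have hT1 : sinh y / cosh y ≤ 1 := (div_le_one (cosh_pos y)).2 (sinh_lt_cosh y).le
  have hT0 : 0 ≤ sinh y / cosh y := div_nonneg (sinh_nonneg_iff.2 hy.le) (cosh_pos y).le
  have hL := half_mul_tanh_le hy
  set T := sinh y / cosh y
  set M := logCosh y / y
  have h1 : (ρ + 1) * (sinh (ρ * y) * (T / 2)) ≤ (ρ + 1) * (sinh (ρ * y) * M) := by gcongr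
  have h2 : T * sinh (ρ * y) ≤ sinh (ρ * y) := mul_le_of_le_one_left hS hT1
  nlinarith [mul_nonneg hT0 hS]

theorem hasDerivAt_gapSlope (ρ : ℝ) {y : ℝ} (hy : 0 < y) :
    HasDerivAt (gapSlope ρ) (exp (ρ * logCosh y) *
      ((ρ + 1) * (sinh (ρ * y) * (coshGap y / y ^ 2)) +
        ρ * ((ρ + 1) * (logCosh y / y) - (ρ - 1) * (sinh y / cosh y)) *
          (cosh ((ρ + 1) * y) / cosh y)) / (ρ + 1) ^ 2) y := by
  have h1 : HasDerivAt (fun y => ρ * y) ρ y := by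
    simpa using (hasDerivAt_id y).const_mul ρ
  have hL := hasDerivAt_logCosh y
  have hT := hasDerivAt_sinh_div_cosh y
  have h := ((hL.const_mul ρ).exp.mul ((((h1.sinh.mul (hL.div (hasDerivAt_id y) hy.ne')).const_mul
    (ρ + 1)).add h1.cosh).sub ((hT.mul h1.sinh).const_mul ρ))).div_const ((ρ + 1) ^ 2)
  refine h.congr_deriv ?_
  congr 1
  have hc := cosh_pos y
  have hC : cosh ((ρ + 1) * y) = cosh (ρ * y) * cosh y + sinh (ρ * y) * sinh y := by
    rw [← cosh_add]; ring_nf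
  have hsq : cosh y ^ 2 = sinh y ^ 2 + 1 := by linarith [cosh_sq_sub_sinh_sq y]
  simp only [id, Pi.mul_apply, Pi.add_apply, Pi.sub_apply, Pi.div_apply, hC, coshGap]
  rw [show 1 / cosh y ^ 2 = 1 - (sinh y / cosh y) ^ 2 by field_simp; linarith]
  rw [show (cosh (ρ * y) * cosh y + sinh (ρ * y) * sinh y) / cosh y =
    cosh (ρ * y) + sinh (ρ * y) * (sinh y / cosh y) by field_simp]
  generalize sinh y / cosh y = T
  field_simp
  ring

theorem gapSlope_monotoneOn {ρ : ℝ} (hρ : 0 ≤ ρ) (hρ3 : ρ ≤ 3) :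
    MonotoneOn (gapSlope ρ) (Ioi 0) := by
  refine monotoneOn_Ioi_of_hasDerivAt (fun y hy => hasDerivAt_gapSlope ρ hy) (fun y hy => ?_)
  refine div_nonneg (mul_nonneg (exp_pos _).le (add_nonneg ?_ ?_)) (sq_nonneg _)
  · have := sinh_nonneg_iff.2 (mul_nonneg hρ hy.le)
    have := coshGap_nonneg hy.le
    positivity
  · have hL := half_mul_tanh_le hy
    have hT0 : 0 ≤ sinh y / cosh y := div_nonneg (sinh_nonneg_iff.2 hy.le) (cosh_pos y).le
    refine mul_nonneg (mul_nonneg hρ ?_) (div_pos (cosh_pos _) (cosh_pos _)).le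
    nlinarith

theorem exists_support_coshRatio_mul_coshGap {ρ : ℝ} (hρ : 0 ≤ ρ) (hρ3 : ρ ≤ 3) {a : ℝ}
    (ha : 0 ≤ a) :
    ∃ κ, 0 ≤ κ ∧ ∀ y, 0 ≤ y →
      κ * (coshGap ((ρ + 1) * y) - coshGap ((ρ + 1) * a)) ≤
        coshRatio (ρ + 1) y * coshGap y - coshRatio (ρ + 1) a * coshGap a := by
  refine exists_support (f := fun y => coshRatio (ρ + 1) y * coshGap y)
    (h := fun y => coshGap ((ρ + 1) * y)) (k := gapSlope ρ)
    (h' := fun y => (ρ + 1) ^ 2 * y / cosh ((ρ + 1) * y) ^ 2) (by fun_prop) (by fun_prop)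
    (fun y hy => ?_)
    (fun y _ => hasDerivAt_coshGap_mul _ y) (fun y hy => by positivity)
    (fun y hy => gapSlope_nonneg hρ hρ3 hy) (gapSlope_monotoneOn hρ hρ3) ha
  refine ((hasDerivAt_coshRatio (ρ + 1) y).mul (hasDerivAt_coshGap y)).congr_deriv ?_
  have hc := cosh_pos y
  have hC := cosh_pos ((ρ + 1) * y)
  have hs : sinh (ρ * y) = sinh ((ρ + 1) * y) * cosh y - cosh ((ρ + 1) * y) * sinh y := by
    rw [← sinh_sub]; ring_nf
  have hch : cosh (ρ * y) = cosh ((ρ + 1) * y) * cosh y - sinh ((ρ + 1) * y) * sinh y := by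
    rw [← cosh_sub]; ring_nf
  have hsq : sinh y ^ 2 = cosh y ^ 2 - 1 := by linarith [cosh_sq_sub_sinh_sq y]
  rw [coshRatio_add_one, gapSlope, hs, hch, coshGap]
  field_simp
  ring_nf
  simp only [hsq]
  ring

theorem logCosh_sub_self (y : ℝ) : logCosh y - y = log ((1 + exp (-y) * exp (-y)) / 2) := by
  conv_lhs => rw [← log_exp y, log_exp y]
  rw [logCosh, ← log_exp y, ← log_div (cosh_pos _).ne' (exp_pos _).ne', log_exp, cosh_eq, exp_neg]
  congr 1
  field_simp

theorem tendsto_logCosh_sub_self :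
    Tendsto (fun y => logCosh y - y) atTop (𝓝 (-log 2)) := by
  have h0 := tendsto_exp_neg_atTop_nhds_zero
  have h1 : Tendsto (fun y : ℝ => (1 + exp (-y) * exp (-y)) / 2) atTop (𝓝 ((1 + 0 * 0) / 2)) :=
    ((h0.mul h0).const_add 1).div_const 2
  have h2 := h1.log (by norm_num)
  simp only [← logCosh_sub_self] at h2
  simpa using h2

theorem tendsto_coshGap : Tendsto coshGap atTop (𝓝 (log 2)) := by
  have h1 : Tendsto (fun y : ℝ => y * exp (-y) / cosh y) atTop (𝓝 0) := by
    have h := tendsto_pow_mul_exp_neg_atTop_nhds_zero 1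
    simp only [pow_one] at h
    refine tendsto_of_tendsto_of_tendsto_of_le_of_le' tendsto_const_nhds h ?_ ?_
    · filter_upwards [eventually_ge_atTop 0] with y hy
      exact div_nonneg (mul_nonneg hy (exp_pos _).le) (cosh_pos y).le
    · filter_upwards [eventually_ge_atTop 0] with y hy
      exact div_le_self (mul_nonneg hy (exp_pos _).le) (one_le_cosh y)
  have h2 := (h1.add tendsto_logCosh_sub_self).neg
  simp only [zero_add, neg_neg] at h2
  refine h2.congr fun y => ?_
  have hc := cosh_pos y
  rw [coshGap, ← cosh_sub_sinh y]
  field_simp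
  ring

theorem tendsto_coshRatio {ρ : ℝ} (hρ : -1 < ρ) :
    Tendsto (coshRatio (ρ + 1)) atTop (𝓝 ((2 : ℝ) ^ (-ρ))) := by
  have hr : 0 < ρ + 1 := by linarith
  have h1 := ((tendsto_logCosh_sub_self.const_mul (ρ + 1)).sub
    (tendsto_logCosh_sub_self.comp (tendsto_id.const_mul_atTop hr))).rexp
  rw [rpow_def_of_pos two_pos]
  convert h1 using 2
  · simp only [coshRatio, Function.comp_apply, id]
    congr 1
    ring
  · ring_nf

/-- The pairs `(d, e)` of functions of `ρ` such that, for an output letter of a given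
log-likelihood ratio, `d ρ` is its normalized contribution to `exp (-E₀)` and `e ρ` is minus the
logarithmic derivative of `d` at `ρ`. -/
def IsProfile (d e : ℝ → ℝ) : Prop :=
  (∃ t, 0 ≤ t ∧ d = (fun ρ => coshRatio (ρ + 1) (t / (ρ + 1))) ∧
    e = fun ρ => coshGap (t / (ρ + 1))) ∨
  (d = (fun ρ => (2 : ℝ) ^ (-ρ)) ∧ e = fun _ => log 2)

namespace IsProfile

variable {d e : ℝ → ℝ} {ρ : ℝ}

theorem pos (h : IsProfile d e) (ρ : ℝ) : 0 < d ρ := by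
  rcases h with ⟨t, -, rfl, rfl⟩ | ⟨rfl, rfl⟩
  · exact coshRatio_pos _ _
  · exact rpow_pos_of_pos two_pos _

theorem apply_zero (h : IsProfile d e) : d 0 = 1 := by
  rcases h with ⟨t, -, rfl, rfl⟩ | ⟨rfl, rfl⟩ <;> simp [coshRatio]

theorem gap_nonneg (h : IsProfile d e) (hρ : -1 < ρ) : 0 ≤ e ρ := by
  rcases h with ⟨t, ht, rfl, rfl⟩ | ⟨rfl, rfl⟩
  · exact coshGap_nonneg (div_nonneg ht (by linarith))
  · exact log_nonneg one_le_two

theorem hasDerivAt (h : IsProfile d e) (hρ : -1 < ρ) : HasDerivAt d (-(d ρ * e ρ)) ρ := by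
  have hr : ρ + 1 ≠ 0 := by linarith
  rcases h with ⟨t, -, rfl, rfl⟩ | ⟨rfl, rfl⟩
  · have h1 : HasDerivAt (fun ρ => ρ + 1) 1 ρ := (hasDerivAt_id ρ).add_const 1
    have h2 : HasDerivAt (fun ρ => t / (ρ + 1)) (-t / (ρ + 1) ^ 2) ρ := by
      refine ((hasDerivAt_const ρ t).div h1 hr).congr_deriv ?_
      ring
    have h3 := ((h1.mul ((hasDerivAt_logCosh _).comp ρ h2)).sub_const (logCosh t)).exp
    have h4 : HasDerivAt (fun ρ => exp ((ρ + 1) * logCosh (t / (ρ + 1)) - logCosh t))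
        (-(coshRatio (ρ + 1) (t / (ρ + 1)) * coshGap (t / (ρ + 1)))) ρ := by
      refine h3.congr_deriv ?_
      simp only [coshRatio, coshGap, Function.comp_apply, Pi.mul_apply]
      rw [mul_div_cancel₀ t hr]
      field_simp
      ring
    refine h4.congr_of_eventuallyEq ?_
    filter_upwards [lt_mem_nhds hρ] with r hr
    rw [coshRatio, mul_div_cancel₀ t (by linarith)]
  · refine ((hasDerivAt_neg ρ).const_rpow two_pos).congr_deriv ?_
    ring

end IsProfile

theorem coshGap_mono {x y : ℝ} (hx : 0 ≤ x) (hxy : x ≤ y) : coshGap x ≤ coshGap y :=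
  le_of_hasDerivAt_nonneg hxy continuous_coshGap.continuousOn (fun z _ => hasDerivAt_coshGap z)
    (fun _ hz => div_nonneg (hx.trans hz.1.le) (sq_nonneg _))

theorem coshGap_le_log_two {y : ℝ} (hy : 0 ≤ y) : coshGap y ≤ log 2 := by
  refine ge_of_tendsto tendsto_coshGap ?_
  filter_upwards [eventually_ge_atTop y] with z hz
  exact coshGap_mono hy hz

namespace IsProfile

variable {d e : ℝ → ℝ} {ρ : ℝ}

theorem gap_le (h : IsProfile d e) (hρ : -1 < ρ) : e ρ ≤ log 2 := by
  rcases h with ⟨t, ht, rfl, rfl⟩ | ⟨rfl, rfl⟩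
  · exact coshGap_le_log_two (div_nonneg ht (by linarith))
  · exact le_rfl

theorem induction_on {P : ℝ → ℝ → ℝ → Prop} (h : IsProfile d e) (hρ : -1 < ρ)
    (hP : ∀ y, 0 ≤ y → P (coshGap ((ρ + 1) * y)) (coshRatio (ρ + 1) y) (coshGap y))
    (hlim : (∀ y, 0 ≤ y → P (coshGap ((ρ + 1) * y)) (coshRatio (ρ + 1) y) (coshGap y)) →
      P (log 2) (2 ^ (-ρ)) (log 2)) :
    P (e 0) (d ρ) (e ρ) := by
  have hr : 0 < ρ + 1 := by linarith
  rcases h with ⟨t, ht, rfl, rfl⟩ | ⟨rfl, rfl⟩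
  · have := hP (t / (ρ + 1)) (div_nonneg ht hr.le)
    rw [mul_div_cancel₀ t hr.ne'] at this
    simpa using this
  · exact hlim hP

theorem exists_support {t : ℝ} (ht : 0 ≤ t) (hρ : 0 ≤ ρ) :
    ∃ κ, 0 ≤ κ ∧ ∀ d e, IsProfile d e →
      κ * (e 0 - coshGap t) ≤ coshRatio (ρ + 1) (t / (ρ + 1)) - d ρ := by
  have hr : 0 < ρ + 1 := by linarith
  obtain ⟨κ, hκ, H⟩ := exists_support_coshRatio hρ (div_nonneg ht hr.le)
  rw [mul_div_cancel₀ t hr.ne'] at H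
  refine ⟨κ, hκ, fun d e h => ?_⟩
  refine induction_on (P := fun a b _ => κ * (a - coshGap t) ≤ coshRatio (ρ + 1) (t / (ρ + 1)) - b)
    h (by linarith) H fun H => ?_
  refine le_of_tendsto_of_tendsto
    (((tendsto_coshGap.comp (tendsto_id.const_mul_atTop hr)).sub_const _).const_mul κ)
    ((tendsto_coshRatio (by linarith)).const_sub _) ?_
  filter_upwards [eventually_ge_atTop 0] with y hy using H y hy

theorem exists_support_mul {t : ℝ} (ht : 0 ≤ t) (hρ : 0 ≤ ρ) (hρ3 : ρ ≤ 3) :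
    ∃ κ, 0 ≤ κ ∧ ∀ d e, IsProfile d e →
      κ * (e 0 - coshGap t) ≤
        d ρ * e ρ - coshRatio (ρ + 1) (t / (ρ + 1)) * coshGap (t / (ρ + 1)) := by
  have hr : 0 < ρ + 1 := by linarith
  obtain ⟨κ, hκ, H⟩ := exists_support_coshRatio_mul_coshGap hρ hρ3 (div_nonneg ht hr.le)
  rw [mul_div_cancel₀ t hr.ne'] at H
  refine ⟨κ, hκ, fun d e h => ?_⟩
  refine induction_on (P := fun a b c => κ * (a - coshGap t) ≤
    b * c - coshRatio (ρ + 1) (t / (ρ + 1)) * coshGap (t / (ρ + 1)))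
    h (by linarith) H fun H => ?_
  refine le_of_tendsto_of_tendsto
    (((tendsto_coshGap.comp (tendsto_id.const_mul_atTop hr)).sub_const _).const_mul κ)
    (((tendsto_coshRatio (by linarith)).mul tendsto_coshGap).sub_const _) ?_
  filter_upwards [eventually_ge_atTop 0] with y hy using H y hy

theorem zero : IsProfile (fun ρ => coshRatio (ρ + 1) (0 / (ρ + 1)))
    (fun ρ => coshGap (0 / (ρ + 1))) :=
  Or.inl ⟨0, le_rfl, rfl, rfl⟩

theorem infinity : IsProfile (fun ρ => (2 : ℝ) ^ (-ρ)) (fun _ => log 2) := Or.inr ⟨rfl, rfl⟩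

theorem chord (h : IsProfile d e) (hρ : 0 ≤ ρ) :
    (1 - d ρ) * log 2 ≤ e 0 * (1 - 2 ^ (-ρ)) := by
  have h0 := h.gap_nonneg (ρ := 0) (by norm_num)
  have h1 := h.gap_le (ρ := 0) (by norm_num)
  rcases h with ⟨t, ht, rfl, rfl⟩ | ⟨rfl, rfl⟩
  · obtain ⟨κ, hκ, H⟩ := exists_support ht hρ
    have hz := H _ _ zero
    have hi := H _ _ infinity
    simp only [zero_add, div_one, zero_div, coshGap_zero, coshRatio_zero] at *
    nlinarith [mul_le_mul_of_nonneg_left hi h0, mul_le_mul_of_nonneg_left hz (sub_nonneg.2 h1)]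
  · linarith

theorem chord_mul (h : IsProfile d e) (hρ : 0 ≤ ρ) (hρ3 : ρ ≤ 3) :
    d ρ * e ρ ≤ e 0 * 2 ^ (-ρ) := by
  have h0 := h.gap_nonneg (ρ := 0) (by norm_num)
  have h1 := h.gap_le (ρ := 0) (by norm_num)
  have hl : 0 < log 2 := log_pos one_lt_two
  rcases h with ⟨t, ht, rfl, rfl⟩ | ⟨rfl, rfl⟩
  · obtain ⟨κ, hκ, H⟩ := exists_support_mul ht hρ hρ3
    have hz := H _ _ zero
    have hi := H _ _ infinity
    simp only [zero_add, div_one, zero_div, coshGap_zero, coshRatio_zero] at *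
    refine le_of_mul_le_mul_right ?_ hl
    nlinarith [mul_le_mul_of_nonneg_left hi h0, mul_le_mul_of_nonneg_left hz (sub_nonneg.2 h1)]
  · linarith

end IsProfile

theorem exists_isProfile_of_pos {a b : ℝ} (ha : 0 < a) (hb : 0 < b) :
    ∃ d e, IsProfile d e ∧ ∀ ρ, -1 < ρ →
      ((1/2) * a ^ (1/(1+ρ)) + (1/2) * b ^ (1/(1+ρ))) ^ (1+ρ) = (a + b) / 2 * d ρ := by
  obtain ⟨t, ht⟩ : ∃ t, t = (log a - log b) / 2 := ⟨_, rfl⟩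
  obtain ⟨m, hm⟩ : ∃ m, m = (log a + log b) / 2 := ⟨_, rfl⟩
  refine ⟨_, _, Or.inl ⟨|t|, abs_nonneg t, rfl, rfl⟩, fun ρ hρ => ?_⟩
  have hr : 0 < ρ + 1 := by linarith
  have h1 : (a + b) / 2 = exp m * cosh t := by
    rw [cosh_eq, mul_div_assoc', mul_add, ← exp_add, ← exp_add,
      show m + t = log a by rw [hm, ht]; ring, show m + -t = log b by rw [hm, ht]; ring,
      exp_log ha, exp_log hb]
  have h2 : (1/2) * a ^ (1/(1+ρ)) + (1/2) * b ^ (1/(1+ρ)) =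
      exp (m / (ρ + 1)) * cosh (t / (ρ + 1)) := by
    rw [rpow_def_of_pos ha, rpow_def_of_pos hb, cosh_eq, mul_div_assoc' (exp _),
      mul_add (exp _), ← exp_add, ← exp_add, show log a = m + t by rw [hm, ht]; ring,
      show log b = m - t by rw [hm, ht]; ring, add_comm 1 ρ]
    ring_nf
  have h3 : logCosh (|t| / (ρ + 1)) = logCosh (t / (ρ + 1)) := by
    rw [logCosh, logCosh, ← cosh_abs (t / (ρ + 1)), abs_div, abs_of_pos hr]
  rw [h1, h2, rpow_def_of_pos (by have := cosh_pos (t / (ρ + 1)); positivity),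
    log_mul (exp_pos _).ne' (cosh_pos _).ne', log_exp, coshRatio, mul_div_cancel₀ _ hr.ne', h3,
    exp_sub, logCosh, logCosh, cosh_abs, exp_log (cosh_pos _), mul_assoc,
    mul_div_cancel₀ _ (cosh_pos t).ne', ← exp_add]
  congr 1
  field_simp
  ring

theorem exists_isProfile {a b : ℝ} (ha : 0 ≤ a) (hb : 0 ≤ b) :
    ∃ d e, IsProfile d e ∧ ∀ ρ, -1 < ρ →
      ((1/2) * a ^ (1/(1+ρ)) + (1/2) * b ^ (1/(1+ρ))) ^ (1+ρ) = (a + b) / 2 * d ρ := by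
  have key : ∀ c : ℝ, 0 ≤ c → ∀ ρ : ℝ, -1 < ρ →
      ((1/2) * c ^ (1/(1+ρ))) ^ (1+ρ) = c / 2 * 2 ^ (-ρ) := by
    intro c hc ρ hρ
    have hr : 1 + ρ ≠ 0 := by linarith
    rw [mul_rpow (by norm_num) (rpow_nonneg hc _), ← rpow_mul hc, one_div_mul_cancel hr, rpow_one,
      one_div, inv_rpow zero_le_two, rpow_add two_pos, rpow_neg zero_le_two, rpow_one]
    field_simp
  have hz : ∀ ρ : ℝ, -1 < ρ → (0 : ℝ) ^ (1/(1+ρ)) = 0 := fun ρ hρ =>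
    zero_rpow (one_div_ne_zero (by linarith))
  rcases ha.eq_or_lt with rfl | ha
  · exact ⟨_, _, IsProfile.infinity, fun ρ hρ => by
      rw [hz ρ hρ, mul_zero, zero_add, zero_add, key b hb ρ hρ]⟩
  rcases hb.eq_or_lt with rfl | hb
  · exact ⟨_, _, IsProfile.infinity, fun ρ hρ => by
      rw [hz ρ hρ, mul_zero, add_zero, add_zero, key a ha.le ρ hρ]⟩
  exact exists_isProfile_of_pos ha hb

theorem IsProfile.hasDerivAt_neg_log_sum {ι : Type*} [Fintype ι] {q : ι → ℝ} {d e : ι → ℝ → ℝ}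
    (h : ∀ i, IsProfile (d i) (e i)) {ρ : ℝ} (hρ : -1 < ρ) (hS : ∑ i, q i * d i ρ ≠ 0) :
    HasDerivAt (fun ρ => -log (∑ i, q i * d i ρ))
      ((∑ i, q i * (d i ρ * e i ρ)) / ∑ i, q i * d i ρ) ρ := by
  have h1 : HasDerivAt (fun ρ => ∑ i, q i * d i ρ) (∑ i, q i * (-(d i ρ * e i ρ))) ρ :=
    HasDerivAt.fun_sum fun i _ => ((h i).hasDerivAt hρ).const_mul (q i)
  refine (h1.log hS).neg.congr_deriv ?_
  simp only [mul_neg, Finset.sum_neg_distrib, neg_div, neg_neg]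

theorem Rbec_eq {ε ρ : ℝ} (hε0 : 0 ≤ ε) (hε1 : ε ≤ 1) :
    Rbec ρ ε = (2 : ℝ) ^ (-ρ) * (1 - ε) * log 2 / ((2 : ℝ) ^ (-ρ) * (1 - ε) + ε) := by
  have hS : (2 : ℝ) ^ (-ρ) * (1 - ε) + ε ≠ 0 := by
    have : (0 : ℝ) < 2 ^ (-ρ) := rpow_pos_of_pos two_pos _
    rcases hε0.eq_or_lt with rfl | h
    · simpa using this.ne'
    · have := mul_nonneg this.le (sub_nonneg.2 hε1)
      positivity
  have h1 : HasDerivAt (fun ρ => -log ((2 : ℝ) ^ (-ρ) * (1 - ε) + ε)) _ ρ :=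
    (((((hasDerivAt_neg ρ).const_rpow two_pos).mul_const (1 - ε)).add_const ε).log hS).neg
  rw [Rbec, funext (fun r => E0bec.eq_1 r ε), h1.deriv]
  ring

theorem exists_isProfile_E0bsc {x : ℝ} (hx0 : 0 ≤ x) (hx1 : x ≤ 1) :
    ∃ d e, IsProfile d e ∧ ∀ ρ, -1 < ρ → E0bsc ρ x = -log (d ρ) ∧ Rbsc ρ x = e ρ := by
  obtain ⟨d, e, h, H⟩ := exists_isProfile hx0 (sub_nonneg.2 hx1)
  have h1 : ∀ ρ, -1 < ρ → E0bsc ρ x = -log (d ρ) := by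
    intro ρ hρ
    have := H ρ hρ
    rw [← mul_add, mul_rpow (by norm_num) (by have := sub_nonneg.2 hx1; positivity), one_div,
      inv_rpow zero_le_two, rpow_add two_pos, rpow_one] at this
    rw [E0bsc, show d ρ = 2 * ((x + (1 - x)) / 2 * d ρ) by ring, ← this, rpow_neg zero_le_two]
    congr 2
    field_simp
  refine ⟨d, e, h, fun ρ hρ => ⟨h1 ρ hρ, ?_⟩⟩
  have h2 := ((h.hasDerivAt hρ).log (h.pos ρ).ne').neg
  have h3 : (fun r => E0bsc r x) =ᶠ[𝓝 ρ] fun r => -log (d r) := by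
    filter_upwards [lt_mem_nhds hρ] with r hr using h1 r hr
  rw [Rbsc, (h2.congr_of_eventuallyEq h3).deriv, neg_div, neg_neg,
    mul_div_cancel_left₀ _ (h.pos ρ).ne']

theorem exists_isProfile_E0 (W : BDMC) :
    ∃ (q : W.Y → ℝ) (d e : W.Y → ℝ → ℝ), (∀ y, 0 ≤ q y) ∧ ∑ y, q y = 1 ∧
      (∀ y, IsProfile (d y) (e y)) ∧ ∀ ρ, -1 < ρ →
        0 < ∑ y, q y * d y ρ ∧ E0 ρ W = -log (∑ y, q y * d y ρ) ∧
        RW ρ W = (∑ y, q y * (d y ρ * e y ρ)) / ∑ y, q y * d y ρ := by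
  choose d e h H using fun y => exists_isProfile (W.W0_nonneg y) (W.W1_nonneg y)
  have hq : ∑ y, (W.W0 y + W.W1 y) / 2 = 1 := by
    rw [← Finset.sum_div, Finset.sum_add_distrib, W.sum_W0, W.sum_W1]; norm_num
  have hq0 : ∀ y, 0 ≤ (W.W0 y + W.W1 y) / 2 := fun y => by
    have := W.W0_nonneg y
    have := W.W1_nonneg y
    positivity
  have hS : ∀ ρ, 0 < ∑ y, (W.W0 y + W.W1 y) / 2 * d y ρ := by
    intro ρ
    obtain ⟨y, -, hy⟩ := Finset.exists_ne_zero_of_sum_ne_zero (hq.trans_ne one_ne_zero)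
    exact Finset.sum_pos' (fun y _ => mul_nonneg (hq0 y) ((h y).pos ρ).le)
      ⟨y, Finset.mem_univ y, mul_pos ((hq0 y).lt_of_ne' hy) ((h y).pos ρ)⟩
  have hE : ∀ ρ, -1 < ρ → E0 ρ W = -log (∑ y, (W.W0 y + W.W1 y) / 2 * d y ρ) := by
    intro ρ hρ
    rw [E0, Finset.sum_congr rfl fun y _ => H y ρ hρ]
  refine ⟨fun y => (W.W0 y + W.W1 y) / 2, d, e, hq0, hq, h, fun ρ hρ => ⟨hS ρ, hE ρ hρ, ?_⟩⟩
  have h3 : (fun r => E0 r W) =ᶠ[𝓝 ρ] fun r => -log (∑ y, (W.W0 y + W.W1 y) / 2 * d y r) := by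
    filter_upwards [lt_mem_nhds hρ] with r hr using hE r hr
  exact ((IsProfile.hasDerivAt_neg_log_sum h hρ (hS ρ).ne').congr_of_eventuallyEq h3).deriv

namespace IsProfile

variable {ι : Type*} [Fintype ι] {q : ι → ℝ} {d e : ι → ℝ → ℝ} {ρ : ℝ}

theorem sum_le_coshRatio (h : ∀ i, IsProfile (d i) (e i)) (hq : ∀ i, 0 ≤ q i)
    (hq1 : ∑ i, q i = 1) (hρ : 0 ≤ ρ) {t : ℝ} (ht : 0 ≤ t) (hle : coshGap t ≤ ∑ i, q i * e i 0) :
    ∑ i, q i * d i ρ ≤ coshRatio (ρ + 1) (t / (ρ + 1)) := by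
  obtain ⟨κ, hκ, H⟩ := exists_support ht hρ
  have h1 := Finset.sum_le_sum fun i (_ : i ∈ Finset.univ) =>
    mul_le_mul_of_nonneg_left (H _ _ (h i)) (hq i)
  have h2 : ∑ i, q i * (κ * (e i 0 - coshGap t)) =
      κ * (∑ i, q i * e i 0 - (∑ i, q i) * coshGap t) := by
    rw [Finset.sum_mul, ← Finset.sum_sub_distrib, Finset.mul_sum]
    exact Finset.sum_congr rfl fun i _ => by ring
  simp only [h2, mul_sub (q _), Finset.sum_sub_distrib, ← Finset.sum_mul, hq1, one_mul] at h1
  have := mul_nonneg hκ (sub_nonneg.2 hle)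
  linarith

theorem coshRatio_mul_coshGap_le_sum (h : ∀ i, IsProfile (d i) (e i)) (hq : ∀ i, 0 ≤ q i)
    (hq1 : ∑ i, q i = 1) (hρ : 0 ≤ ρ) (hρ3 : ρ ≤ 3) {t : ℝ} (ht : 0 ≤ t)
    (hle : coshGap t ≤ ∑ i, q i * e i 0) :
    coshRatio (ρ + 1) (t / (ρ + 1)) * coshGap (t / (ρ + 1)) ≤ ∑ i, q i * (d i ρ * e i ρ) := by
  obtain ⟨κ, hκ, H⟩ := exists_support_mul ht hρ hρ3
  have h1 := Finset.sum_le_sum fun i (_ : i ∈ Finset.univ) =>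
    mul_le_mul_of_nonneg_left (H _ _ (h i)) (hq i)
  have h2 : ∑ i, q i * (κ * (e i 0 - coshGap t)) =
      κ * (∑ i, q i * e i 0 - (∑ i, q i) * coshGap t) := by
    rw [Finset.sum_mul, ← Finset.sum_sub_distrib, Finset.mul_sum]
    exact Finset.sum_congr rfl fun i _ => by ring
  simp only [h2, mul_sub (q _), Finset.sum_sub_distrib, ← Finset.sum_mul, hq1, one_mul] at h1
  have := mul_nonneg hκ (sub_nonneg.2 hle)
  linarith

/-- A statement continuous in the profile and valid for all finite profiles of smaller capacity
holds for every profile. -/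
theorem le_of_forall_coshGap_le {d₀ e₀ : ℝ → ℝ} (h : IsProfile d₀ e₀) (hρ : -1 < ρ) {C A B c : ℝ}
    (hC : e₀ 0 ≤ C)
    (H : ∀ t, 0 ≤ t → coshGap t ≤ C →
      A + c * (coshRatio (ρ + 1) (t / (ρ + 1)) * coshGap (t / (ρ + 1))) ≤
        B * coshRatio (ρ + 1) (t / (ρ + 1))) :
    A + c * (d₀ ρ * e₀ ρ) ≤ B * d₀ ρ := by
  have hr : 0 < ρ + 1 := by linarith
  rcases h with ⟨t, ht, rfl, rfl⟩ | ⟨rfl, rfl⟩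
  · exact H t ht (by simpa using hC)
  · have hlim : Tendsto (fun t : ℝ => t / (ρ + 1)) atTop atTop := tendsto_id.atTop_div_const hr
    refine le_of_tendsto_of_tendsto
      (((((tendsto_coshRatio hρ).comp hlim).mul (tendsto_coshGap.comp hlim)).const_mul c).const_add A)
      (((tendsto_coshRatio hρ).comp hlim).const_mul B) ?_
    filter_upwards [eventually_ge_atTop 0] with t ht
    exact H t ht ((coshGap_le_log_two ht).trans hC)

theorem sum_le (h : ∀ i, IsProfile (d i) (e i)) (hq : ∀ i, 0 ≤ q i)
    (hq1 : ∑ i, q i = 1) (hρ : 0 ≤ ρ) {d₀ e₀ : ℝ → ℝ} (h₀ : IsProfile d₀ e₀)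
    (hle : e₀ 0 ≤ ∑ i, q i * e i 0) :
    ∑ i, q i * d i ρ ≤ d₀ ρ := by
  have := le_of_forall_coshGap_le (A := ∑ i, q i * d i ρ) (B := 1) (c := 0) h₀
    (show -1 < ρ by linarith) hle fun t ht hC => by
      simpa using sum_le_coshRatio h hq hq1 hρ ht hC
  simpa using this

theorem mul_le_sum (h : ∀ i, IsProfile (d i) (e i)) (hq : ∀ i, 0 ≤ q i)
    (hq1 : ∑ i, q i = 1) (hρ : 0 ≤ ρ) (hρ3 : ρ ≤ 3) {d₀ e₀ : ℝ → ℝ} (h₀ : IsProfile d₀ e₀)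
    (hle : e₀ 0 ≤ ∑ i, q i * e i 0) :
    d₀ ρ * e₀ ρ ≤ ∑ i, q i * (d i ρ * e i ρ) := by
  have := le_of_forall_coshGap_le (A := -∑ i, q i * (d i ρ * e i ρ)) (B := 0) (c := 1) h₀
    (show -1 < ρ by linarith) hle fun t ht hC => by
      linarith [coshRatio_mul_coshGap_le_sum h hq hq1 hρ hρ3 ht hC]
  linarith

theorem le_sum (h : ∀ i, IsProfile (d i) (e i)) (hq : ∀ i, 0 ≤ q i)
    (hq1 : ∑ i, q i = 1) (hρ : 0 ≤ ρ) {ε : ℝ}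
    (hle : ∑ i, q i * e i 0 ≤ (1 - ε) * log 2) :
    2 ^ (-ρ) * (1 - ε) + ε ≤ ∑ i, q i * d i ρ := by
  have hl : 0 < log 2 := log_pos one_lt_two
  have h1 := Finset.sum_le_sum fun i (_ : i ∈ Finset.univ) =>
    mul_le_mul_of_nonneg_left ((h i).chord hρ) (hq i)
  simp only [← mul_assoc, ← Finset.sum_mul, mul_sub (q _), Finset.sum_sub_distrib, mul_one,
    hq1] at h1
  have h2 : (2 : ℝ) ^ (-ρ) ≤ 1 := rpow_le_one_of_one_le_of_nonpos one_le_two (by linarith)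
  refine le_of_mul_le_mul_right ?_ hl
  nlinarith [mul_le_mul_of_nonneg_right hle (sub_nonneg.2 h2)]

theorem sum_mul_le (h : ∀ i, IsProfile (d i) (e i)) (hq : ∀ i, 0 ≤ q i) (hρ : 0 ≤ ρ)
    (hρ3 : ρ ≤ 3) {ε : ℝ} (hle : ∑ i, q i * e i 0 ≤ (1 - ε) * log 2) :
    ∑ i, q i * (d i ρ * e i ρ) ≤ 2 ^ (-ρ) * (1 - ε) * log 2 := by
  have h1 := Finset.sum_le_sum fun i (_ : i ∈ Finset.univ) =>
    mul_le_mul_of_nonneg_left ((h i).chord_mul hρ hρ3) (hq i)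
  simp only [← mul_assoc (q _) (e _ _), ← Finset.sum_mul] at h1
  nlinarith [mul_le_mul_of_nonneg_right hle (rpow_nonneg zero_le_two (-ρ))]

end IsProfile

/-- Theorem 1, case `ρ₁ = 0`: if the symmetric capacities are ordered,
`R(0, BSC_x) ≤ R(0, W) ≤ R(0, BEC_ε)`, then the rates are ordered for all
`ρ₂ ∈ [0,3]` and the `E₀` values are ordered for all `ρ₂ ≥ 0`. -/
theorem extremality_capacity (W : BDMC) (ε x : ℝ)
    (hε : ε ∈ Set.Icc (0:ℝ) 1) (hx : x ∈ Set.Icc (0:ℝ) (1/2))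
    (hBSC : Rbsc 0 x ≤ RW 0 W) (hBEC : RW 0 W ≤ Rbec 0 ε) :
    (∀ ρ₂ ∈ Set.Icc (0:ℝ) 3, Rbsc ρ₂ x ≤ RW ρ₂ W ∧ RW ρ₂ W ≤ Rbec ρ₂ ε) ∧
    (∀ ρ₂ : ℝ, 0 ≤ ρ₂ → E0bsc ρ₂ x ≤ E0 ρ₂ W ∧ E0 ρ₂ W ≤ E0bec ρ₂ ε) := by
  obtain ⟨q, d, e, hq, hq1, h, H⟩ := exists_isProfile_E0 W
  obtain ⟨d₀, e₀, h₀, H₀⟩ := exists_isProfile_E0bsc hx.1 (hx.2.trans (by norm_num))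
  have hcap : RW 0 W = ∑ y, q y * e y 0 := by
    rw [(H 0 (by norm_num)).2.2]
    simp [(h _).apply_zero, hq1]
  rw [hcap] at hBSC hBEC
  rw [(H₀ 0 (by norm_num)).2] at hBSC
  rw [Rbec_eq hε.1 hε.2] at hBEC
  replace hBEC : ∑ y, q y * e y 0 ≤ (1 - ε) * log 2 := by simpa using hBEC
  have hpos : ∀ ρ : ℝ, 0 < (2 : ℝ) ^ (-ρ) * (1 - ε) + ε := by
    intro ρ
    have h2 : (0 : ℝ) < 2 ^ (-ρ) := rpow_pos_of_pos two_pos _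
    rcases hε.1.eq_or_lt with h0 | h0
    · simpa [← h0] using h2
    · have := mul_nonneg h2.le (sub_nonneg.2 hε.2)
      positivity
  refine ⟨fun ρ hρ => ?_, fun ρ hρ => ?_⟩
  · have hρ1 : -1 < ρ := by linarith [hρ.1]
    obtain ⟨hS, -, hR⟩ := H ρ hρ1
    have hN := IsProfile.mul_le_sum h hq hq1 hρ.1 hρ.2 h₀ hBSC
    rw [hR, (H₀ ρ hρ1).2, Rbec_eq hε.1 hε.2]
    constructor
    · rw [le_div_iff₀ hS]
      nlinarith [mul_le_mul_of_nonneg_right (IsProfile.sum_le h hq hq1 hρ.1 h₀ hBSC)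
        (h₀.gap_nonneg hρ1)]
    · have h1 := IsProfile.sum_mul_le h hq hρ.1 hρ.2 hBEC
      have h2 := IsProfile.le_sum h hq hq1 hρ.1 hBEC
      have h3 : 0 ≤ (2 : ℝ) ^ (-ρ) * (1 - ε) * log 2 :=
        mul_nonneg (mul_nonneg (rpow_nonneg zero_le_two _) (sub_nonneg.2 hε.2))
          (log_nonneg one_le_two)
      exact div_le_div₀ h3 h1 (hpos ρ) h2
  · obtain ⟨hS, hE, -⟩ := H ρ (by linarith)
    rw [hE, (H₀ ρ (by linarith)).1, E0bec]
    exact ⟨neg_le_neg (log_le_log hS (IsProfile.sum_le h hq hq1 hρ h₀ hBSC)),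
      neg_le_neg (log_le_log (hpos ρ) (IsProfile.le_sum h hq hq1 hρ hBEC))⟩
end

section
/- (Corollary 2.) Let W be a B-DMC with finite output alphabet, ε ∈ [0, 1], x ∈ [0, 1/2]. If the symmetric capacities coincide, i.e. R(0, W) = R(0, BEC_ε) = R(0, BSC_x), then for every rate R ≥ 0 the random coding exponents satisfy sup_{ρ∈[0,1]} (E0(ρ, BSC_x) − ρR) ≤ sup_{ρ∈[0,1]} (E0(ρ, W) − ρR) ≤ sup_{ρ∈[0,1]} (E0(ρ, BEC_ε) − ρR). -/
open Real Set

/-- The contribution of an output letter with conditional probabilities `a`, `b` to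
`exp (-E₀(ρ, ·))`. -/
noncomputable def gallagerTerm (ρ a b : ℝ) : ℝ :=
  ((1/2) * a ^ (1/(1+ρ)) + (1/2) * b ^ (1/(1+ρ))) ^ (1+ρ)

/-- The Gallager term of the symmetric channel with bias `z`. -/
noncomputable def biasGallager (ρ z : ℝ) : ℝ := gallagerTerm ρ (1+z) (1-z)

/-- The capacity of the symmetric channel with bias `z`. -/
noncomputable def biasCapacity (z : ℝ) : ℝ :=
  ((1+z) * log (1+z) + (1-z) * log (1-z)) / 2

/-- Half the log-likelihood ratio of the symmetric channel with bias `z`. -/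
noncomputable def halfLLR (z : ℝ) : ℝ := (log (1+z) - log (1-z)) / 2

/-- Minus the slope of the Gallager term with respect to the capacity, as a function of the
half log-likelihood ratio. -/
noncomputable def negSlope (ρ u : ℝ) : ℝ :=
  cosh (1/(1+ρ) * u) ^ ρ * (sinh (ρ * (1/(1+ρ)) * u) / u)

lemma gallagerTerm_comm (ρ a b : ℝ) : gallagerTerm ρ a b = gallagerTerm ρ b a := by
  unfold gallagerTerm; rw [add_comm]

lemma gallagerTerm_mul {ρ m a b : ℝ} (hρ : -1 < ρ) (hm : 0 ≤ m) (ha : 0 ≤ a) (hb : 0 ≤ b) :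
    gallagerTerm ρ (m * a) (m * b) = m * gallagerTerm ρ a b := by
  have h : 1 + ρ ≠ 0 := by linarith
  unfold gallagerTerm
  rw [mul_rpow hm ha, mul_rpow hm hb]
  have : (1/2) * (m ^ (1/(1+ρ)) * a ^ (1/(1+ρ))) + (1/2) * (m ^ (1/(1+ρ)) * b ^ (1/(1+ρ)))
      = m ^ (1/(1+ρ)) * ((1/2) * a ^ (1/(1+ρ)) + (1/2) * b ^ (1/(1+ρ))) := by ring
  rw [this, mul_rpow (by positivity) (by positivity), ← rpow_mul hm, one_div_mul_cancel h,
    rpow_one]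

lemma biasGallager_neg (ρ z : ℝ) : biasGallager ρ (-z) = biasGallager ρ z := by
  unfold biasGallager
  rw [gallagerTerm_comm, sub_neg_eq_add, ← sub_eq_add_neg]

lemma biasCapacity_neg (z : ℝ) : biasCapacity (-z) = biasCapacity z := by
  unfold biasCapacity
  rw [sub_neg_eq_add, ← sub_eq_add_neg, add_comm]

lemma biasGallager_abs (ρ z : ℝ) : biasGallager ρ |z| = biasGallager ρ z := by
  rcases abs_choice z with h | h <;> rw [h]
  exact biasGallager_neg ρ z

lemma biasCapacity_abs (z : ℝ) : biasCapacity |z| = biasCapacity z := by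
  rcases abs_choice z with h | h <;> rw [h]
  exact biasCapacity_neg z

lemma biasGallager_zero (ρ : ℝ) : biasGallager ρ 0 = 1 := by
  norm_num [biasGallager, gallagerTerm]

lemma biasCapacity_zero : biasCapacity 0 = 0 := by
  norm_num [biasCapacity]

lemma biasCapacity_one : biasCapacity 1 = log 2 := by
  norm_num [biasCapacity]

lemma biasGallager_one {ρ : ℝ} (hρ : 0 ≤ ρ) : biasGallager ρ 1 = 2 ^ (-ρ) := by
  have h : 1 + ρ ≠ 0 := by linarith
  have h' : (1 + ρ)⁻¹ ≠ 0 := inv_ne_zero h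
  unfold biasGallager gallagerTerm
  rw [sub_self, one_div (1 + ρ), zero_rpow h', mul_zero, add_zero,
    mul_rpow (by norm_num) (by positivity), ← rpow_mul (by norm_num), inv_mul_cancel₀ h,
    one_div, inv_rpow (by norm_num), ← rpow_neg (by norm_num), one_add_one_eq_two]
  rw [neg_add, rpow_add (by norm_num), rpow_neg_one]
  ring

lemma continuous_biasGallager {ρ : ℝ} (hρ : 0 ≤ ρ) : Continuous (biasGallager ρ) := by
  have h : 0 ≤ 1 / (1 + ρ) := by positivity
  have h' : 0 ≤ 1 + ρ := by positivity
  unfold biasGallager gallagerTerm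
  exact ((((continuous_const.add continuous_id).rpow_const fun _ => Or.inr h).const_mul _).add
    (((continuous_const.sub continuous_id).rpow_const fun _ => Or.inr h).const_mul _)).rpow_const
      fun _ => Or.inr h'

lemma continuous_biasCapacity : Continuous biasCapacity := by
  unfold biasCapacity
  exact ((continuous_mul_log.comp (continuous_const.add continuous_id)).add
    (continuous_mul_log.comp (continuous_const.sub continuous_id))).div_const 2

lemma hasDerivAt_biasCapacity {z : ℝ} (hz : z ∈ Ioo (0:ℝ) 1) :
    HasDerivAt biasCapacity (halfLLR z) z := by
  have ha : 1 + z ≠ 0 := by linarith [hz.1]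
  have hb : 1 - z ≠ 0 := by linarith [hz.2]
  have h1 := (hasDerivAt_mul_log ha).comp z ((hasDerivAt_id z).const_add 1)
  have h2 := (hasDerivAt_mul_log hb).comp z ((hasDerivAt_id z).const_sub 1)
  refine HasDerivAt.congr_deriv ((h1.add h2).div_const 2) ?_
  simp only [halfLLR]; ring

lemma halfLLR_pos {z : ℝ} (hz : z ∈ Ioo (0:ℝ) 1) : 0 < halfLLR z := by
  have := log_lt_log (show 0 < 1 - z by linarith [hz.2]) (show 1 - z < 1 + z by linarith [hz.1])
  unfold halfLLR; linarith

lemma halfLLR_mono {z w : ℝ} (hz : z ∈ Ioo (0:ℝ) 1) (hw : w ∈ Ioo (0:ℝ) 1) (h : z ≤ w) :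
    halfLLR z ≤ halfLLR w := by
  have h1 := log_le_log (show 0 < 1 + z by linarith [hz.1]) (show 1 + z ≤ 1 + w by linarith)
  have h2 := log_le_log (show 0 < 1 - w by linarith [hw.2]) (show 1 - w ≤ 1 - z by linarith)
  unfold halfLLR; linarith

lemma hasDerivAt_biasGallager {ρ z : ℝ} (hρ : 0 ≤ ρ) (hz : z ∈ Ioo (0:ℝ) 1) :
    HasDerivAt (biasGallager ρ) (-(halfLLR z * negSlope ρ (halfLLR z))) z := by
  have ha : 0 < 1 + z := by linarith [hz.1]
  have hb : 0 < 1 - z := by linarith [hz.2]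
  have h0 : 1 + ρ ≠ 0 := by linarith
  have hu := halfLLR_pos hz
  have h1 := (((hasDerivAt_id z).const_add 1).rpow_const (p := 1/(1+ρ))
    (Or.inl ha.ne')).const_mul (1/2)
  have h2 := (((hasDerivAt_id z).const_sub 1).rpow_const (p := 1/(1+ρ))
    (Or.inl hb.ne')).const_mul (1/2)
  have hM : 0 < (1/2) * (1 + z) ^ (1/(1+ρ)) + (1/2) * (1 - z) ^ (1/(1+ρ)) := by positivity
  have h3 := (h1.add h2).rpow_const (p := 1 + ρ) (Or.inl hM.ne')
  refine HasDerivAt.congr_deriv h3 ?_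
  simp only [id, Pi.add_apply]
  set s := 1/(1+ρ) with hs
  have hs1 : s * (1 + ρ) = 1 := one_div_mul_cancel h0
  have hs2 : s - 1 = -(ρ * s) := by linarith
  set u := halfLLR z with hu'
  set L := (log (1+z) + log (1-z)) / 2 with hL
  have e1 : log (1+z) = L + u := by rw [hL, hu', halfLLR]; ring
  have e2 : log (1-z) = L - u := by rw [hL, hu', halfLLR]; ring
  have hMeq : (1/2) * (1 + z) ^ s + (1/2) * (1 - z) ^ s = exp (L * s) * cosh (s * u) := by
    rw [rpow_def_of_pos ha, rpow_def_of_pos hb, e1, e2, cosh_eq,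
      show (L + u) * s = L * s + s * u by ring, show (L - u) * s = L * s + -(s * u) by ring,
      exp_add, exp_add]
    ring
  have hDeq : (1 + z) ^ (s - 1) - (1 - z) ^ (s - 1)
      = -(2 * exp (-(L * s * ρ)) * sinh (ρ * s * u)) := by
    rw [rpow_def_of_pos ha, rpow_def_of_pos hb, e1, e2, sinh_eq, hs2,
      show (L + u) * -(ρ * s) = -(L * s * ρ) + -(ρ * s * u) by ring,
      show (L - u) * -(ρ * s) = -(L * s * ρ) + ρ * s * u by ring,
      exp_add, exp_add]
    ring
  rw [hMeq, add_sub_cancel_left, mul_rpow (exp_pos _).le (cosh_pos _).le, ← exp_mul]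
  have : (1/2 * (1 * s * (1 + z) ^ (s - 1)) + 1/2 * (-1 * s * (1 - z) ^ (s - 1))) * (1 + ρ)
      = (s * (1 + ρ)) / 2 * ((1 + z) ^ (s - 1) - (1 - z) ^ (s - 1)) := by ring
  rw [this, hs1, hDeq, exp_neg, negSlope, ← hs]
  have := (exp_pos (L * s * ρ)).ne'
  field_simp

lemma sinh_mul_le {t y : ℝ} (ht : t ∈ Icc (0:ℝ) 1) (hy : 0 ≤ y) :
    sinh (t * y) ≤ t * sinh y := by
  have hd (v : ℝ) : HasDerivAt (fun v => t * sinh v - sinh (t * v))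
      (t * cosh v - cosh (t * v) * (t * 1)) v :=
    ((hasDerivAt_sinh v).const_mul t).sub (((hasDerivAt_id v).const_mul t).sinh)
  have hmono : MonotoneOn (fun v => t * sinh v - sinh (t * v)) (Ici 0) := by
    refine monotoneOn_of_deriv_nonneg (convex_Ici 0)
      (fun v _ => (hd v).continuousAt.continuousWithinAt)
      (fun v _ => (hd v).differentiableAt.differentiableWithinAt) fun v hv => ?_
    rw [interior_Ici, mem_Ioi] at hv
    rw [(hd v).deriv]
    have : cosh (t * v) ≤ cosh v := by
      rw [cosh_le_cosh, abs_of_nonneg (mul_nonneg ht.1 hv.le), abs_of_pos hv]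
      exact mul_le_of_le_one_left hv.le ht.2
    nlinarith [mul_le_mul_of_nonneg_left this ht.1]
  have := hmono self_mem_Ici (mem_Ici.2 hy) hy
  simp at this
  linarith

lemma negSlope_nonneg {ρ u : ℝ} (hρ : 0 ≤ ρ) (hu : 0 < u) : 0 ≤ negSlope ρ u := by
  have h1 : 0 ≤ sinh (ρ * (1/(1+ρ)) * u) := sinh_nonneg_iff.2 (by positivity)
  have h2 := cosh_pos (1/(1+ρ) * u)
  unfold negSlope; positivity

lemma negSlope_mono {ρ u v : ℝ} (hρ : 0 ≤ ρ) (hu : 0 < u) (huv : u ≤ v) :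
    negSlope ρ u ≤ negSlope ρ v := by
  have hv : 0 < v := hu.trans_le huv
  have hs : 0 ≤ 1/(1+ρ) := by positivity
  unfold negSlope
  have h1 : 0 ≤ sinh (ρ * (1/(1+ρ)) * u) := sinh_nonneg_iff.2 (by positivity)
  have h2 : cosh (1/(1+ρ) * u) ≤ cosh (1/(1+ρ) * v) := by
    rw [cosh_le_cosh, abs_of_nonneg (by positivity), abs_of_nonneg (by positivity)]
    gcongr
  have h3 : sinh (ρ * (1/(1+ρ)) * u) / u ≤ sinh (ρ * (1/(1+ρ)) * v) / v := by
    have := sinh_mul_le (t := u / v) (y := ρ * (1/(1+ρ)) * v)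
      ⟨by positivity, (div_le_one hv).2 huv⟩ (by positivity)
    rw [show u / v * (ρ * (1/(1+ρ)) * v) = ρ * (1/(1+ρ)) * u by field_simp] at this
    rw [div_le_iff₀ hu]
    calc _ ≤ _ := this
      _ = _ := by ring
  exact mul_le_mul (rpow_le_rpow (cosh_pos _).le h2 hρ) h3 (by positivity)
    (rpow_nonneg (cosh_pos _).le _)

/-- As a function of the capacity, the Gallager term lies below its tangents. -/
lemma biasGallager_le_tangent {ρ w z : ℝ} (hρ : 0 ≤ ρ) (hw : w ∈ Ioo (0:ℝ) 1)
    (hz : z ∈ Icc (0:ℝ) 1) :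
    biasGallager ρ z ≤ biasGallager ρ w
      - negSlope ρ (halfLLR w) * (biasCapacity z - biasCapacity w) := by
  set k := negSlope ρ (halfLLR w) with hk
  have hd {v : ℝ} (hv : v ∈ Ioo (0:ℝ) 1) :
      HasDerivAt (fun v => biasGallager ρ v + k * biasCapacity v)
        (-(halfLLR v * negSlope ρ (halfLLR v)) + k * halfLLR v) v :=
    (hasDerivAt_biasGallager hρ hv).add ((hasDerivAt_biasCapacity hv).const_mul k)
  have hc : Continuous (fun v => biasGallager ρ v + k * biasCapacity v) :=
    (continuous_biasGallager hρ).add (continuous_biasCapacity.const_mul k)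
  suffices biasGallager ρ z + k * biasCapacity z ≤ biasGallager ρ w + k * biasCapacity w by
    linarith
  rcases le_total z w with h | h
  · have hsub {v : ℝ} (hv : v ∈ interior (Icc z w)) : v ∈ Ioo (0:ℝ) 1 := by
      rw [interior_Icc] at hv
      exact ⟨hz.1.trans_lt hv.1, hv.2.trans hw.2⟩
    have hmono := monotoneOn_of_deriv_nonneg (convex_Icc z w) hc.continuousOn
      (fun v hv => (hd (hsub hv)).differentiableAt.differentiableWithinAt) fun v hv => by
        have hv' := hsub hv
        rw [interior_Icc] at hv
        rw [(hd hv').deriv]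
        have h1 := negSlope_mono hρ (halfLLR_pos hv') (halfLLR_mono hv' hw hv.2.le)
        nlinarith [mul_le_mul_of_nonneg_left h1 (halfLLR_pos hv').le]
    exact hmono (left_mem_Icc.2 h) (right_mem_Icc.2 h) h
  · have hsub {v : ℝ} (hv : v ∈ interior (Icc w z)) : v ∈ Ioo (0:ℝ) 1 := by
      rw [interior_Icc] at hv
      exact ⟨hw.1.trans hv.1, hv.2.trans_le hz.2⟩
    have hanti := antitoneOn_of_deriv_nonpos (convex_Icc w z) hc.continuousOn
      (fun v hv => (hd (hsub hv)).differentiableAt.differentiableWithinAt) fun v hv => by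
        have hv' := hsub hv
        rw [interior_Icc] at hv
        rw [(hd hv').deriv]
        have h1 := negSlope_mono hρ (halfLLR_pos hw) (halfLLR_mono hw hv' hv.1.le)
        nlinarith [mul_le_mul_of_nonneg_left h1 (halfLLR_pos hv').le]
    exact hanti (left_mem_Icc.2 h) (right_mem_Icc.2 h) h

lemma biasCapacity_mem {z : ℝ} (hz : z ∈ Icc (0:ℝ) 1) : biasCapacity z ∈ Icc 0 (log 2) := by
  have hmono : MonotoneOn biasCapacity (Icc 0 1) :=
    monotoneOn_of_deriv_nonneg (convex_Icc 0 1) continuous_biasCapacity.continuousOn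
      (fun v hv => (hasDerivAt_biasCapacity
        (by rwa [interior_Icc] at hv)).differentiableAt.differentiableWithinAt) fun v hv => by
        rw [interior_Icc] at hv
        rw [(hasDerivAt_biasCapacity hv).deriv]
        exact (halfLLR_pos hv).le
  constructor
  · have := hmono (left_mem_Icc.2 zero_le_one) hz hz.1
    rwa [biasCapacity_zero] at this
  · have := hmono hz (right_mem_Icc.2 zero_le_one) hz.2
    rwa [biasCapacity_one] at this

lemma biasGallager_le_one {ρ z : ℝ} (hρ : 0 ≤ ρ) (hz : z ∈ Icc (0:ℝ) 1) :
    biasGallager ρ z ≤ 1 := by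
  have hs : 0 ≤ 1/(1+ρ) := by positivity
  have hs1 : 1/(1+ρ) ≤ 1 := by rw [div_le_one (by positivity)]; linarith
  have ha : 0 ≤ 1 + z := by linarith [hz.1]
  have hb : 0 ≤ 1 - z := by linarith [hz.2]
  have h := (concaveOn_rpow hs hs1).2 (mem_Ici.2 ha) (mem_Ici.2 hb)
    (show (0:ℝ) ≤ 1/2 by norm_num) (show (0:ℝ) ≤ 1/2 by norm_num) (by norm_num)
  simp only [smul_eq_mul] at h
  rw [show (1/2) * (1 + z) + (1/2) * (1 - z) = (1:ℝ) by ring, one_rpow] at h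
  exact rpow_le_one (by positivity) h (by positivity)

/-- As a function of the capacity, the Gallager term lies above its chord. -/
lemma chord_le_biasGallager {ρ z : ℝ} (hρ : 0 ≤ ρ) (hz : z ∈ Icc (0:ℝ) 1) :
    log 2 - (1 - 2 ^ (-ρ)) * biasCapacity z ≤ log 2 * biasGallager ρ z := by
  rcases hz.1.eq_or_lt with rfl | h0
  · simp [biasCapacity_zero, biasGallager_zero]
  rcases hz.2.eq_or_lt with rfl | h1
  · rw [biasCapacity_one, biasGallager_one hρ]; linarith
  have hl := biasGallager_le_tangent hρ ⟨h0, h1⟩ (left_mem_Icc.2 zero_le_one)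
  have hr := biasGallager_le_tangent hρ ⟨h0, h1⟩ (right_mem_Icc.2 zero_le_one)
  rw [biasGallager_zero, biasCapacity_zero] at hl
  rw [biasGallager_one hρ, biasCapacity_one] at hr
  obtain ⟨hc0, hc1⟩ := biasCapacity_mem hz
  have e1 := mul_le_mul_of_nonneg_left hl (sub_nonneg.2 hc1)
  have e2 := mul_le_mul_of_nonneg_left hr hc0
  linarith

/-- The contribution of an output letter with conditional probabilities `a`, `b` to the
symmetric capacity. -/
noncomputable def capacityTerm (a b : ℝ) : ℝ :=
  (a * log a + b * log b) / 2 - (a + b) / 2 * log ((a + b) / 2)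

lemma hasDerivAt_rpow_one_div {a : ℝ} (ha : 0 ≤ a) :
    HasDerivAt (fun ρ : ℝ => a ^ (1/(1+ρ))) (-(a * log a)) 0 := by
  have hi : HasDerivAt (fun ρ : ℝ => 1/(1+ρ)) (-1) 0 := by
    have := ((hasDerivAt_id (0:ℝ)).const_add 1).inv (by norm_num)
    simp only [one_div]
    exact this.congr_deriv (by norm_num)
  rcases ha.eq_or_lt with rfl | ha
  · have : (fun ρ : ℝ => (0:ℝ) ^ (1/(1+ρ))) =ᶠ[nhds 0] fun _ => 0 := by
      filter_upwards [lt_mem_nhds (show (-1:ℝ) < 0 by norm_num)] with ρ hρ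
      have : 1 + ρ ≠ 0 := by linarith
      exact zero_rpow (one_div_ne_zero this)
    simpa using (hasDerivAt_const (0:ℝ) (0:ℝ)).congr_of_eventuallyEq this
  · convert hi.const_rpow ha using 1
    simp [mul_comm]

lemma hasDerivAt_gallagerTerm {a b : ℝ} (ha : 0 ≤ a) (hb : 0 ≤ b) :
    HasDerivAt (fun ρ => gallagerTerm ρ a b) (-capacityTerm a b) 0 := by
  rcases (add_nonneg ha hb).eq_or_lt with h | h
  · obtain rfl : a = 0 := by linarith
    obtain rfl : b = 0 := by linarith
    have : (fun ρ => gallagerTerm ρ 0 0) =ᶠ[nhds 0] fun _ => 0 := by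
      filter_upwards [lt_mem_nhds (show (-1:ℝ) < 0 by norm_num)] with ρ hρ
      have h := gallagerTerm_mul (m := 0) hρ le_rfl le_rfl le_rfl
      rwa [zero_mul, zero_mul] at h
    simpa [capacityTerm] using (hasDerivAt_const (0:ℝ) (0:ℝ)).congr_of_eventuallyEq this
  · have h1 := ((hasDerivAt_rpow_one_div ha).const_mul (1/2)).add
      ((hasDerivAt_rpow_one_div hb).const_mul (1/2))
    have h2 := h1.rpow ((hasDerivAt_id (0:ℝ)).const_add 1) (by
      simp only [Pi.add_apply]; norm_num; linarith)
    refine HasDerivAt.congr_deriv h2 ?_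
    simp [capacityTerm]
    rw [show 2⁻¹ * a + 2⁻¹ * b = (a + b) / 2 by ring]
    ring

/-- The bias of an output letter with conditional probabilities `a`, `b`. -/
noncomputable def letterBias (a b : ℝ) : ℝ := |(a - b) / (a + b)|

lemma letterBias_mem {a b : ℝ} (ha : 0 ≤ a) (hb : 0 ≤ b) : letterBias a b ∈ Icc (0:ℝ) 1 := by
  refine ⟨abs_nonneg _, ?_⟩
  rw [letterBias, abs_div, abs_of_nonneg (add_nonneg ha hb)]
  refine div_le_one_of_le₀ ?_ (add_nonneg ha hb)
  rw [abs_le]; constructor <;> linarith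

lemma gallagerTerm_eq {ρ a b : ℝ} (hρ : -1 < ρ) (ha : 0 ≤ a) (hb : 0 ≤ b) :
    gallagerTerm ρ a b = (a + b) / 2 * biasGallager ρ (letterBias a b) := by
  rw [letterBias, biasGallager_abs]
  rcases (add_nonneg ha hb).eq_or_lt with h | h
  · obtain rfl : a = 0 := by linarith
    obtain rfl : b = 0 := by linarith
    have h := gallagerTerm_mul (m := 0) hρ le_rfl le_rfl le_rfl
    rw [zero_mul, zero_mul] at h
    simp [h]
  · have e1 : a = (a + b) / 2 * (1 + (a - b) / (a + b)) := by field_simp; ring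
    have e2 : b = (a + b) / 2 * (1 - (a - b) / (a + b)) := by field_simp; ring
    have p1 : 0 ≤ 1 + (a - b) / (a + b) := by
      rw [show 1 + (a - b) / (a + b) = 2 * a / (a + b) by field_simp; ring]; positivity
    have p2 : 0 ≤ 1 - (a - b) / (a + b) := by
      rw [show 1 - (a - b) / (a + b) = 2 * b / (a + b) by field_simp; ring]; positivity
    rw [biasGallager, ← gallagerTerm_mul hρ (by positivity) p1 p2, ← e1, ← e2]

lemma capacityTerm_eq {a b : ℝ} (ha : 0 ≤ a) (hb : 0 ≤ b) :
    capacityTerm a b = (a + b) / 2 * biasCapacity (letterBias a b) := by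
  have h1 := hasDerivAt_gallagerTerm ha hb
  obtain ⟨z0, z1⟩ := letterBias_mem ha hb
  have h2 := (hasDerivAt_gallagerTerm (a := 1 + letterBias a b) (b := 1 - letterBias a b)
    (by linarith) (by linarith)).const_mul ((a + b) / 2)
  have he : (fun ρ => gallagerTerm ρ a b) =ᶠ[nhds 0] fun ρ =>
      (a + b) / 2 * gallagerTerm ρ (1 + letterBias a b) (1 - letterBias a b) := by
    filter_upwards [lt_mem_nhds (show (-1:ℝ) < 0 by norm_num)] with ρ hρ
    exact gallagerTerm_eq hρ ha hb
  have := h1.unique (h2.congr_of_eventuallyEq he)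
  rw [mul_neg, neg_inj] at this
  rw [this]
  simp [capacityTerm, biasCapacity]

lemma sum_half_add (W : BDMC) : ∑ y, (W.W0 y + W.W1 y) / 2 = 1 := by
  rw [← Finset.sum_div, Finset.sum_add_distrib, W.sum_W0, W.sum_W1]; norm_num

lemma E0_eq {ρ : ℝ} (hρ : -1 < ρ) (W : BDMC) :
    E0 ρ W = -log (∑ y, (W.W0 y + W.W1 y) / 2
      * biasGallager ρ (letterBias (W.W0 y) (W.W1 y))) := by
  unfold E0
  congr 2
  exact Finset.sum_congr rfl fun y _ => gallagerTerm_eq hρ (W.W0_nonneg y) (W.W1_nonneg y)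

lemma RW_zero (W : BDMC) :
    RW 0 W = ∑ y, (W.W0 y + W.W1 y) / 2 * biasCapacity (letterBias (W.W0 y) (W.W1 y)) := by
  have h := HasDerivAt.fun_sum (u := Finset.univ) fun y _ =>
    hasDerivAt_gallagerTerm (W.W0_nonneg y) (W.W1_nonneg y)
  have h1 : ∑ y, gallagerTerm 0 (W.W0 y) (W.W1 y) = 1 := by
    rw [← sum_half_add W]
    refine Finset.sum_congr rfl fun y _ => ?_
    simp [gallagerTerm]; ring
  have h2 := (h.log (by rw [h1]; exact one_ne_zero)).neg
  rw [h1, div_one, Finset.sum_neg_distrib, neg_neg] at h2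
  rw [← Finset.sum_congr rfl fun y _ => capacityTerm_eq (W.W0_nonneg y) (W.W1_nonneg y)]
  exact h2.deriv

lemma E0bsc_eq {ρ x : ℝ} (hρ : -1 < ρ) (hx : x ∈ Icc (0:ℝ) (1/2)) :
    E0bsc ρ x = -log (biasGallager ρ (1 - 2 * x)) := by
  obtain ⟨h0, h1⟩ := hx
  have h2 : 0 ≤ 1 - x := by linarith
  have e : biasGallager ρ (1 - 2 * x) = 2 * gallagerTerm ρ x (1 - x) := by
    rw [← gallagerTerm_mul hρ (by norm_num) h0 h2, gallagerTerm_comm, biasGallager]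
    congr 1 <;> ring
  rw [E0bsc, e, gallagerTerm, ← mul_add, mul_rpow (by norm_num) (by positivity), ← mul_assoc]
  congr 3
  rw [one_div, inv_rpow (by norm_num), rpow_add (by norm_num), rpow_one, rpow_neg (by norm_num)]
  field_simp

lemma Rbsc_zero {x : ℝ} (hx : x ∈ Icc (0:ℝ) (1/2)) : Rbsc 0 x = biasCapacity (1 - 2 * x) := by
  have hd := hasDerivAt_gallagerTerm (a := 1 + (1 - 2 * x)) (b := 1 - (1 - 2 * x))
    (by linarith [hx.2]) (by linarith [hx.1])
  have h1 : gallagerTerm 0 (1 + (1 - 2 * x)) (1 - (1 - 2 * x)) = 1 := by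
    simp [gallagerTerm]; ring
  have h2 := (hd.log (by rw [h1]; exact one_ne_zero)).neg
  rw [h1, div_one, neg_neg] at h2
  have he : (fun ρ => E0bsc ρ x) =ᶠ[nhds 0]
      -fun ρ => log (gallagerTerm ρ (1 + (1 - 2 * x)) (1 - (1 - 2 * x))) := by
    filter_upwards [lt_mem_nhds (show (-1:ℝ) < 0 by norm_num)] with ρ hρ
    exact E0bsc_eq hρ hx
  rw [Rbsc, (h2.congr_of_eventuallyEq he).deriv, capacityTerm, add_add_sub_cancel]
  norm_num [biasCapacity]

lemma Rbec_zero (ε : ℝ) : Rbec 0 ε = (1 - ε) * log 2 := by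
  have h := (((hasDerivAt_neg (0:ℝ)).const_rpow (a := 2) (by norm_num)).mul_const
    (1 - ε)).add_const ε
  have h2 := (h.log (by norm_num)).neg
  refine h2.deriv.trans ?_
  norm_num
  ring

/-- At equal symmetric capacity the erasure channel has the largest `E₀`. -/
lemma bec_le_sum {ρ ε : ℝ} {W : BDMC} (hρ : 0 ≤ ρ) (h : RW 0 W = Rbec 0 ε) :
    2 ^ (-ρ) * (1 - ε) + ε ≤ ∑ y, (W.W0 y + W.W1 y) / 2
      * biasGallager ρ (letterBias (W.W0 y) (W.W1 y)) := by
  have hl : 0 < log 2 := log_pos (by norm_num)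
  have hs : ∑ y, (W.W0 y + W.W1 y) / 2 * (log 2 - (1 - 2 ^ (-ρ))
        * biasCapacity (letterBias (W.W0 y) (W.W1 y)))
      ≤ ∑ y, (W.W0 y + W.W1 y) / 2
        * (log 2 * biasGallager ρ (letterBias (W.W0 y) (W.W1 y))) := by
    refine Finset.sum_le_sum fun y _ => mul_le_mul_of_nonneg_left ?_
      (by linarith [W.W0_nonneg y, W.W1_nonneg y])
    exact chord_le_biasGallager hρ (letterBias_mem (W.W0_nonneg y) (W.W1_nonneg y))
  simp only [mul_sub, mul_left_comm _ (log 2), mul_left_comm _ (1 - (2:ℝ) ^ (-ρ))] at hs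
  rw [Finset.sum_sub_distrib, ← Finset.sum_mul, ← Finset.mul_sum, ← Finset.mul_sum,
    sum_half_add, ← RW_zero, h, Rbec_zero] at hs
  refine le_of_mul_le_mul_left ?_ hl
  linarith

/-- At equal symmetric capacity the symmetric channel has the smallest `E₀`. -/
lemma sum_le_bsc {ρ z : ℝ} {W : BDMC} (hρ : 0 ≤ ρ) (hz : z ∈ Icc (0:ℝ) 1)
    (h : RW 0 W = biasCapacity z) :
    ∑ y, (W.W0 y + W.W1 y) / 2 * biasGallager ρ (letterBias (W.W0 y) (W.W1 y))
      ≤ biasGallager ρ z := by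
  have hq (y : W.Y) : 0 ≤ (W.W0 y + W.W1 y) / 2 := by
    linarith [W.W0_nonneg y, W.W1_nonneg y]
  have hm (y : W.Y) := letterBias_mem (W.W0_nonneg y) (W.W1_nonneg y)
  have key {w : ℝ} (hw : w ∈ Ioo (0:ℝ) 1) (hc : biasCapacity w ≤ RW 0 W) :
      ∑ y, (W.W0 y + W.W1 y) / 2 * biasGallager ρ (letterBias (W.W0 y) (W.W1 y))
        ≤ biasGallager ρ w := by
    set k := negSlope ρ (halfLLR w)
    have hk : 0 ≤ k := negSlope_nonneg hρ (halfLLR_pos hw)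
    calc _ ≤ ∑ y, (W.W0 y + W.W1 y) / 2 * (biasGallager ρ w
            - k * (biasCapacity (letterBias (W.W0 y) (W.W1 y)) - biasCapacity w)) :=
          Finset.sum_le_sum fun y _ => mul_le_mul_of_nonneg_left
            (biasGallager_le_tangent hρ hw (hm y)) (hq y)
      _ = ∑ y, ((W.W0 y + W.W1 y) / 2 * (biasGallager ρ w + k * biasCapacity w)
            - k * ((W.W0 y + W.W1 y) / 2 * biasCapacity (letterBias (W.W0 y) (W.W1 y)))) :=
          Finset.sum_congr rfl fun y _ => by ring
      _ = biasGallager ρ w - k * (RW 0 W - biasCapacity w) := by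
          rw [Finset.sum_sub_distrib, ← Finset.sum_mul, ← Finset.mul_sum, sum_half_add,
            ← RW_zero]
          ring
      _ ≤ _ := by nlinarith [mul_nonneg hk (sub_nonneg.2 hc)]
  rcases hz.1.eq_or_lt with rfl | h0
  · rw [biasGallager_zero, ← sum_half_add W]
    exact Finset.sum_le_sum fun y _ =>
      mul_le_of_le_one_right (hq y) (biasGallager_le_one hρ (hm y))
  rcases hz.2.eq_or_lt with rfl | h1
  · have ht : Filter.Tendsto (biasGallager ρ) (nhdsWithin 1 (Iio 1))
        (nhds (biasGallager ρ 1)) :=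
      (continuous_biasGallager hρ).continuousAt.tendsto.mono_left nhdsWithin_le_nhds
    refine ge_of_tendsto ht ?_
    filter_upwards [Ioo_mem_nhdsLT (zero_lt_one' ℝ)] with w hw
    refine key hw ?_
    rw [h, biasCapacity_one]
    exact (biasCapacity_mem ⟨hw.1.le, hw.2.le⟩).2
  · exact key ⟨h0, h1⟩ h.ge

/-- Corollary 2: if the symmetric capacities coincide,
`R(0, W) = R(0, BEC_ε) = R(0, BSC_x)`, then for every rate `R ≥ 0` the random
coding exponents `sup_{ρ∈[0,1]} (E₀(ρ, ·) − ρR)` are ordered with BSC smallest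
and BEC largest. -/
theorem extremality_corollary2 (W : BDMC) (ε x : ℝ)
    (hε : ε ∈ Set.Icc (0:ℝ) 1) (hx : x ∈ Set.Icc (0:ℝ) (1/2))
    (h1 : RW 0 W = Rbec 0 ε) (h2 : RW 0 W = Rbsc 0 x) :
    ∀ R : ℝ, 0 ≤ R →
      sSup ((fun ρ => E0bsc ρ x - ρ * R) '' Set.Icc 0 1) ≤
        sSup ((fun ρ => E0 ρ W - ρ * R) '' Set.Icc 0 1) ∧
      sSup ((fun ρ => E0 ρ W - ρ * R) '' Set.Icc 0 1) ≤
        sSup ((fun ρ => E0bec ρ ε - ρ * R) '' Set.Icc 0 1) := by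
  obtain ⟨hε0, hε1⟩ := hε
  have hz : 1 - 2 * x ∈ Set.Icc (0:ℝ) 1 := ⟨by linarith [hx.2], by linarith [hx.1]⟩
  have hbec {ρ : ℝ} (hρ : 0 ≤ ρ) : (2:ℝ) ^ (-ρ) ≤ 2 ^ (-ρ) * (1 - ε) + ε := by
    have : (2:ℝ) ^ (-ρ) ≤ 1 := rpow_le_one_of_one_le_of_nonpos (by norm_num) (by linarith)
    nlinarith [mul_le_mul_of_nonneg_left this hε0]
  have hpos (ρ : ℝ) : (0:ℝ) < 2 ^ (-ρ) := by positivity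
  have hlow {ρ : ℝ} (hρ : 0 ≤ ρ) : E0bsc ρ x ≤ E0 ρ W := by
    rw [E0bsc_eq (by linarith) hx, E0_eq (by linarith)]
    refine neg_le_neg (log_le_log ((hpos ρ).trans_le ((hbec hρ).trans (bec_le_sum hρ h1))) ?_)
    exact sum_le_bsc hρ hz (h2.trans (Rbsc_zero hx))
  have hup {ρ : ℝ} (hρ : 0 ≤ ρ) : E0 ρ W ≤ E0bec ρ ε := by
    rw [E0_eq (by linarith)]
    exact neg_le_neg (log_le_log ((hpos ρ).trans_le (hbec hρ)) (bec_le_sum hρ h1))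
  intro R hR
  have hbound {ρ : ℝ} (hρ : ρ ∈ Set.Icc (0:ℝ) 1) : E0bec ρ ε - ρ * R ≤ log 2 := by
    have h := log_le_log (hpos ρ) (hbec hρ.1)
    rw [log_rpow (by norm_num)] at h
    have hl : 0 < log 2 := log_pos (by norm_num)
    unfold E0bec
    nlinarith [mul_nonneg hρ.1 hR, mul_le_mul_of_nonneg_right hρ.2 hl.le]
  have hne : (Set.Icc (0:ℝ) 1).Nonempty := ⟨0, by norm_num⟩
  constructor
  · refine csSup_le (hne.image _) ?_
    rintro _ ⟨ρ, hρ, rfl⟩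
    refine le_csSup_of_le ⟨log 2, ?_⟩ (Set.mem_image_of_mem _ hρ)
      (sub_le_sub_right (hlow hρ.1) _)
    rintro _ ⟨r, hr, rfl⟩
    exact (sub_le_sub_right (hup hr.1) _).trans (hbound hr)
  · refine csSup_le (hne.image _) ?_
    rintro _ ⟨ρ, hρ, rfl⟩
    refine le_csSup_of_le ⟨log 2, ?_⟩ (Set.mem_image_of_mem _ hρ)
      (sub_le_sub_right (hup hρ.1) _)
    rintro _ ⟨r, hr, rfl⟩
    exact hbound hr
end

section
/- (Lemma 6.) Let z, z₁, z₂ ∈ [0, 1] and λ ∈ [0, 1] satisfy g(ρ₁, z) = λ·g(ρ₁, z₁) + (1−λ)·g(ρ₁, z₂). Then: (i) if ρ₁ ∈ (−1, 0) and ρ₂ ≥ 0, or 0 < ρ₁ ≤ 1 and ρ₂ ≥ ρ₁, or ρ₁ > 1 and ρ₂ ∈ (−1, 0), one has g(ρ₂, z) ≥ λ·g(ρ₂, z₁) + (1−λ)·g(ρ₂, z₂) (the map t ↦ g(ρ₂, g(ρ₁,·)⁻¹(t)) is concave); (ii) if ρ₁ > 1 and ρ₂ ∈ (0, 1], one has g(ρ₂,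 z) ≤ λ·g(ρ₂, z₁) + (1−λ)·g(ρ₂, z₂) (that map is convex). -/
/-- Gallager's `g` function: `g(ρ, z) = (½(1+z)^{1/(1+ρ)} + ½(1−z)^{1/(1+ρ)})^{1+ρ}`,
with real powers. -/
noncomputable def g (ρ z : ℝ) : ℝ :=
  ((1/2) * (1+z) ^ (1/(1+ρ)) + (1/2) * (1-z) ^ (1/(1+ρ))) ^ (1+ρ)

open Set Real

theorem convexOn_sinh_mul {x : ℝ} (hx : 0 < x) :
    ConvexOn ℝ (Ici 0) fun t => sinh (t * x) := by
  have hd : ∀ t, HasDerivAt (fun t => sinh (t * x)) (cosh (t * x) * x) t := fun t => by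
    simpa using ((hasDerivAt_id t).mul_const x).sinh
  refine MonotoneOn.convexOn_of_deriv (convex_Ici 0) (by fun_prop)
    (fun t _ => (hd t).differentiableAt.differentiableWithinAt) ?_
  intro t ht s hs hts
  rw [interior_Ici, mem_Ioi] at ht hs
  rw [(hd t).deriv, (hd s).deriv]
  refine mul_le_mul_of_nonneg_right (cosh_le_cosh.2 ?_) hx.le
  rw [abs_of_pos (by positivity), abs_of_pos (by positivity)]
  gcongr

theorem sinh_secant_mono {x u v : ℝ} (hx : 0 < x) (hu : -1 < u) (huv : u ≤ v) (hv : 0 ≤ v)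
    (hu1 : u ≠ 1) (hv1 : v ≠ 1) :
    (sinh (u * x) - sinh x) / (u - 1) ≤ (sinh (v * x) - sinh x) / (v - 1) := by
  have hc := convexOn_sinh_mul hx
  have key : ∀ {p q : ℝ}, 0 ≤ p → p ≤ q → p ≠ 1 → q ≠ 1 →
      (sinh (p * x) - sinh x) / (p - 1) ≤ (sinh (q * x) - sinh x) / (q - 1) :=
    fun {p q} hp hpq hp1 hq1 => by
      simpa using hc.secant_mono (a := 1) (x := p) (y := q) (by simp) hp (hp.trans hpq) hp1 hq1 hpq
  rcases le_or_gt 0 u with h | h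
  · exact key h huv hu1 hv1
  refine le_trans ?_ (key le_rfl hv (by norm_num) hv1)
  have h1 : sinh (-u * x) ≤ -u * sinh x := by
    have h0 : (0:ℝ) ∈ Ici (0:ℝ) := by simp
    have h1 : (1:ℝ) ∈ Ici (0:ℝ) := by simp
    simpa using hc.2 h0 h1 (show 0 ≤ 1 + u by linarith) (show 0 ≤ -u by linarith) (by ring)
  rw [neg_mul, sinh_neg] at h1
  rw [div_le_iff_of_neg (by linarith)]
  rw [zero_mul, sinh_zero, zero_sub, zero_sub, neg_div_neg_eq, div_one]
  linarith

/-- The normalized sum inside the power mean of `1 + z` and `1 - z`. -/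
noncomputable def meanPow (s z : ℝ) : ℝ :=
  (1/2) * (1+z) ^ s + (1/2) * (1-z) ^ s

/-- The derivative of `z ↦ meanPow s z ^ (1/s) / (s - 1)`. -/
noncomputable def meanSlope (s z : ℝ) : ℝ :=
  meanPow s z ^ (1/s - 1) * (((1+z) ^ (s-1) - (1-z) ^ (s-1)) / (2 * (s-1)))

theorem meanPow_pos {s z : ℝ} (hz : z ∈ Icc (0:ℝ) 1) : 0 < meanPow s z := by
  have h1 : 0 < (1+z) ^ s := rpow_pos_of_pos (by linarith [hz.1]) _
  have h2 : 0 ≤ (1-z) ^ s := rpow_nonneg (by linarith [hz.2]) _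
  unfold meanPow; linarith

theorem continuousOn_meanPow {s : ℝ} (hs : 0 < s) : ContinuousOn (meanPow s) (Icc 0 1) := by
  unfold meanPow
  refine ContinuousOn.add ?_ ?_ <;>
    exact continuousOn_const.mul (ContinuousOn.rpow_const (by fun_prop) fun _ _ => Or.inr hs.le)

theorem hasDerivAt_rpow_one_add (s : ℝ) {z : ℝ} (hz : z ∈ Ioo (0:ℝ) 1) :
    HasDerivAt (fun z => (1+z) ^ s) (s * (1+z) ^ (s-1)) z := by
  simpa using ((hasDerivAt_id z).const_add 1).rpow_const (p := s)
    (Or.inl (by simp only [id]; linarith [hz.1]))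

theorem hasDerivAt_rpow_one_sub (s : ℝ) {z : ℝ} (hz : z ∈ Ioo (0:ℝ) 1) :
    HasDerivAt (fun z => (1-z) ^ s) (-(s * (1-z) ^ (s-1))) z := by
  simpa using ((hasDerivAt_id z).const_sub 1).rpow_const (p := s)
    (Or.inl (by simp only [id]; linarith [hz.2]))

theorem hasDerivAt_meanPow (s : ℝ) {z : ℝ} (hz : z ∈ Ioo (0:ℝ) 1) :
    HasDerivAt (meanPow s) (s / 2 * ((1+z) ^ (s-1) - (1-z) ^ (s-1))) z := by
  refine (((hasDerivAt_rpow_one_add s hz).const_mul (1/2)).add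
    ((hasDerivAt_rpow_one_sub s hz).const_mul (1/2))).congr_deriv ?_
  ring

theorem hasDerivAt_powMean {s z : ℝ} (hs : 0 < s) (hs1 : s ≠ 1) (hz : z ∈ Ioo (0:ℝ) 1) :
    HasDerivAt (fun z => meanPow s z ^ (1/s) / (s-1)) (meanSlope s z) z := by
  have hs1' : s - 1 ≠ 0 := sub_ne_zero.2 hs1
  refine (((hasDerivAt_meanPow s hz).rpow_const (p := 1/s)
    (Or.inl (meanPow_pos (Ioo_subset_Icc_self hz)).ne')).div_const (s-1)).congr_deriv ?_
  unfold meanSlope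
  field_simp

theorem meanSlope_pos {s z : ℝ} (hs1 : s ≠ 1) (hz : z ∈ Ioo (0:ℝ) 1) :
    0 < meanSlope s z := by
  have ha : 1 - z < 1 + z := by linarith [hz.1]
  have hb : 0 < 1 - z := by linarith [hz.2]
  refine mul_pos (rpow_pos_of_pos (meanPow_pos (Ioo_subset_Icc_self hz)) _) ?_
  rcases lt_or_gt_of_ne hs1 with h | h
  · have := rpow_lt_rpow_of_neg hb ha (z := s-1) (by linarith)
    exact div_pos_of_neg_of_neg (by linarith) (by linarith)
  · have := rpow_lt_rpow hb.le ha (z := s-1) (by linarith)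
    exact div_pos (by linarith) (by linarith)

theorem hasDerivAt_meanSlope {s z : ℝ} (hs : 0 < s) (hs1 : s ≠ 1) (hz : z ∈ Ioo (0:ℝ) 1) :
    HasDerivAt (meanSlope s) (meanPow s z ^ (1/s - 2) * ((1+z) * (1-z)) ^ (s-2)) z := by
  have hs1' : s - 1 ≠ 0 := sub_ne_zero.2 hs1
  have hQ := meanPow_pos (s := s) (Ioo_subset_Icc_self hz)
  have ha : 0 < 1 + z := by linarith [hz.1]
  have hb : 0 < 1 - z := by linarith [hz.2]
  refine (((hasDerivAt_meanPow s hz).rpow_const (p := 1/s-1) (Or.inl hQ.ne')).mul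
    (((hasDerivAt_rpow_one_add (s-1) hz).sub (hasDerivAt_rpow_one_sub (s-1) hz)).div_const
      (2 * (s-1)))).congr_deriv ?_
  have e1 : meanPow s z ^ (1/s - 1) = meanPow s z ^ (1/s - 2) * meanPow s z := by
    rw [← rpow_add_one hQ.ne']; ring_nf
  rw [e1, show 1/s - 1 - 1 = 1/s - 2 by ring, show s - 1 - 1 = s - 2 by ring,
    mul_rpow ha.le hb.le]
  generalize meanPow s z ^ (1/s - 2) = M
  have e : ∀ {t : ℝ}, 0 < t → t ^ (s-1) = t ^ (s-2) * t ∧ t ^ s = t ^ (s-2) * t ^ 2 := by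
    intro t ht
    rw [← rpow_add_one ht.ne', ← rpow_natCast, ← rpow_add ht]
    constructor <;> congr 1 <;> push_cast <;> ring
  unfold meanPow
  rw [Pi.sub_apply, (e ha).1, (e hb).1, (e ha).2, (e hb).2]
  field_simp
  ring

theorem meanPow_mul_diff (s : ℝ) {z : ℝ} (hz : z ∈ Ioo (0:ℝ) 1) :
    meanPow s z * ((1+z) ^ (s-1) - (1-z) ^ (s-1)) =
      ((1+z) * (1-z)) ^ (s - 1/2) *
        (sinh ((2*s-1) * ((log (1+z) - log (1-z)) / 2)) -
          sinh ((log (1+z) - log (1-z)) / 2)) := by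
  have ha : 0 < 1 + z := by linarith [hz.1]
  have hb : 0 < 1 - z := by linarith [hz.2]
  unfold meanPow
  rw [rpow_def_of_pos ha, rpow_def_of_pos hb, rpow_def_of_pos ha, rpow_def_of_pos hb,
    rpow_def_of_pos (mul_pos ha hb), log_mul ha.ne' hb.ne', sinh_eq, sinh_eq]
  generalize log (1+z) = a
  generalize log (1-z) = b
  ring_nf
  simp only [← exp_add]
  ring_nf

theorem monotoneOn_meanSlope_div {s t : ℝ} (hs : 0 < s) (hst : s ≤ t) (ht : 1/2 ≤ t)
    (hs1 : s ≠ 1) (ht1 : t ≠ 1) :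
    MonotoneOn (fun z => meanSlope s z / meanSlope t z) (Ioo 0 1) := by
  have ht0 : 0 < t := by linarith
  have hd := fun z (hz : z ∈ Ioo (0:ℝ) 1) => (hasDerivAt_meanSlope hs hs1 hz).div
    (hasDerivAt_meanSlope ht0 ht1 hz) (meanSlope_pos ht1 hz).ne'
  refine monotoneOn_of_deriv_nonneg (convex_Ioo 0 1)
    (fun z hz => (hd z hz).continuousAt.continuousWithinAt)
    (fun z hz => (hd z (interior_subset hz)).differentiableAt.differentiableWithinAt) ?_
  intro z hz
  rw [interior_Ioo] at hz
  have hQs := meanPow_pos (s := s) (Ioo_subset_Icc_self hz)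
  have hQt := meanPow_pos (s := t) (Ioo_subset_Icc_self hz)
  have ha : 0 < 1 + z := by linarith [hz.1]
  have hb : 0 < 1 - z := by linarith [hz.2]
  refine (hd z hz).deriv.symm ▸ div_nonneg (sub_nonneg.2 ?_) (sq_nonneg _)
  set x := (log (1+z) - log (1-z)) / 2 with hx
  have hx0 : 0 < x := by
    have := log_lt_log hb (show 1 - z < 1 + z by linarith [hz.1])
    rw [hx]; linarith
  have hsec := sinh_secant_mono (x := x) (u := 2*s-1) (v := 2*t-1) hx0 (by linarith)
    (by linarith) (by linarith) (fun h => hs1 (by linarith)) (fun h => ht1 (by linarith))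
  set c := (1+z) * (1-z) with hc
  have hc0 : 0 < c := mul_pos ha hb
  have e : ∀ {r : ℝ}, meanPow r z * (((1+z) ^ (r-1) - (1-z) ^ (r-1)) / (2 * (r-1))) =
      c ^ (r - 2) * c ^ (3/2 : ℝ) * ((sinh ((2*r-1) * x) - sinh x) / (2*r-1-1)) := by
    intro r
    rw [← mul_div_assoc, meanPow_mul_diff r hz, ← rpow_add hc0, ← hx, ← hc, mul_div_assoc,
      show r - 2 + 3/2 = r - 1/2 by ring, show 2*r-1-1 = 2*(r-1) by ring]
  have e1 : ∀ {r : ℝ}, 0 < meanPow r z →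
      meanPow r z ^ (1/r - 1) = meanPow r z ^ (1/r - 2) * meanPow r z := by
    intro r hr
    rw [← rpow_add_one hr.ne']; ring_nf
  unfold meanSlope
  rw [e1 hQs, e1 hQt, mul_assoc (_ ^ (1/s-2)), mul_assoc (_ ^ (1/t-2)), e, e]
  have hK : 0 ≤ meanPow s z ^ (1/s-2) * meanPow t z ^ (1/t-2) *
      (c ^ (s-2) * c ^ (t-2) * c ^ (3/2 : ℝ)) := by positivity
  have := mul_le_mul_of_nonneg_left hsec hK
  linarith

theorem continuousOn_powMean {s : ℝ} (hs : 0 < s) :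
    ContinuousOn (fun z => meanPow s z ^ (1/s) / (s-1)) (Icc 0 1) :=
  ((continuousOn_meanPow hs).rpow_const fun _ hz => Or.inl (meanPow_pos hz).ne').div_const _

theorem strictMonoOn_powMean {s : ℝ} (hs : 0 < s) (hs1 : s ≠ 1) :
    StrictMonoOn (fun z => meanPow s z ^ (1/s) / (s-1)) (Icc 0 1) := by
  refine strictMonoOn_of_deriv_pos (convex_Icc 0 1) (continuousOn_powMean hs) fun z hz => ?_
  rw [interior_Icc] at hz
  rw [(hasDerivAt_powMean hs hs1 hz).deriv]
  exact meanSlope_pos hs1 hz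

theorem powMean_tangent_le {s t : ℝ} (hs : 0 < s) (hst : s ≤ t) (ht : 1/2 ≤ t)
    (hs1 : s ≠ 1) (ht1 : t ≠ 1) {z w : ℝ} (hz : z ∈ Ioo (0:ℝ) 1) (hw : w ∈ Icc (0:ℝ) 1) :
    meanSlope s z * (meanPow t w ^ (1/t) / (t-1) - meanPow t z ^ (1/t) / (t-1)) ≤
      meanSlope t z * (meanPow s w ^ (1/s) / (s-1) - meanPow s z ^ (1/s) / (s-1)) := by
  have ht0 : 0 < t := by linarith
  set F : ℝ → ℝ := fun w => meanSlope t z * (meanPow s w ^ (1/s) / (s-1)) -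
    meanSlope s z * (meanPow t w ^ (1/t) / (t-1)) with hF
  have hFc : ContinuousOn F (Icc 0 1) :=
    (continuousOn_const.mul (continuousOn_powMean hs)).sub
      (continuousOn_const.mul (continuousOn_powMean ht0))
  have hd := fun y (hy : y ∈ Ioo (0:ℝ) 1) =>
    ((hasDerivAt_powMean hs hs1 hy).const_mul (meanSlope t z)).sub
      ((hasDerivAt_powMean ht0 ht1 hy).const_mul (meanSlope s z))
  have hr : ∀ {x y}, x ∈ Ioo (0:ℝ) 1 → y ∈ Ioo (0:ℝ) 1 → x ≤ y →
      meanSlope s x * meanSlope t y ≤ meanSlope s y * meanSlope t x := fun {x y} hx hy hxy =>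
    (div_le_div_iff₀ (meanSlope_pos ht1 hx) (meanSlope_pos ht1 hy)).1
      (monotoneOn_meanSlope_div hs hst ht hs1 ht1 hx hy hxy)
  suffices F z ≤ F w by simp only [hF] at this; linarith
  rcases le_total w z with h | h
  · refine antitoneOn_of_deriv_nonpos (convex_Icc 0 z) (hFc.mono (Icc_subset_Icc_right hz.2.le))
      ?_ ?_ ⟨hw.1, h⟩ ⟨hz.1.le, le_rfl⟩ h <;> rw [interior_Icc] <;> intro y hy
    · exact (hd y ⟨hy.1, hy.2.trans hz.2⟩).differentiableAt.differentiableWithinAt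
    · have hy' : y ∈ Ioo (0:ℝ) 1 := ⟨hy.1, hy.2.trans hz.2⟩
      refine (hd y hy').deriv.trans_le ?_
      linarith [hr hy' hz hy.2.le]
  · refine monotoneOn_of_deriv_nonneg (convex_Icc z 1) (hFc.mono (Icc_subset_Icc_left hz.1.le))
      ?_ ?_ ⟨le_rfl, hz.2.le⟩ ⟨h, hw.2⟩ h <;> rw [interior_Icc] <;> intro y hy
    · exact (hd y ⟨hz.1.trans hy.1, hy.2⟩).differentiableAt.differentiableWithinAt
    · have hy' : y ∈ Ioo (0:ℝ) 1 := ⟨hz.1.trans hy.1, hy.2⟩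
      refine le_of_le_of_eq ?_ (hd y hy').deriv.symm
      linarith [hr hz hy' hy.1.le]

theorem eq_convexComb_of_endpoint {f h : ℝ → ℝ} {z z₁ z₂ l : ℝ}
    (hf : StrictMonoOn f (Icc 0 1)) (hz : z = 0 ∨ z = 1) (hz₁ : z₁ ∈ Icc (0:ℝ) 1)
    (hz₂ : z₂ ∈ Icc (0:ℝ) 1) (hl : l ∈ Icc (0:ℝ) 1) (hfz : f z = l * f z₁ + (1-l) * f z₂) :
    h z = l * h z₁ + (1-l) * h z₂ := by
  have hzI : z ∈ Icc (0:ℝ) 1 := by rcases hz with rfl | rfl <;> simp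
  have h0 : l * (f z₁ - f z) = 0 ∧ (1-l) * (f z₂ - f z) = 0 := by
    have hl' : 0 ≤ 1 - l := by linarith [hl.2]
    rcases hz with rfl | rfl
    · have a1 := mul_nonneg hl.1 (sub_nonneg.2 (hf.monotoneOn hzI hz₁ hz₁.1))
      have a2 := mul_nonneg hl' (sub_nonneg.2 (hf.monotoneOn hzI hz₂ hz₂.1))
      constructor <;> linarith
    · have a1 := mul_nonneg hl.1 (sub_nonneg.2 (hf.monotoneOn hz₁ hzI hz₁.2))
      have a2 := mul_nonneg hl' (sub_nonneg.2 (hf.monotoneOn hz₂ hzI hz₂.2))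
      constructor <;> linarith
  have key : ∀ {c y : ℝ}, y ∈ Icc (0:ℝ) 1 → c * (f y - f z) = 0 → c * (h y - h z) = 0 := by
    intro c y hy hc
    rcases mul_eq_zero.1 hc with hc | hc
    · rw [hc, zero_mul]
    · rw [hf.injOn hy hzI (sub_eq_zero.1 hc), sub_self, mul_zero]
  linarith [key hz₁ h0.1, key hz₂ h0.2]

theorem g_eq (ρ z : ℝ) : g ρ z = meanPow (1/(1+ρ)) z ^ (1/(1/(1+ρ))) := by
  rw [one_div_one_div]; rfl

theorem g_zero {z : ℝ} : g 0 z = 1 := by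
  norm_num [g]
  ring

theorem one_div_one_add_sub_one {ρ : ℝ} (hρ : -1 < ρ) : 1/(1+ρ) - 1 = -(ρ/(1+ρ)) := by
  have : 1 + ρ ≠ 0 := by linarith
  field_simp
  ring

/-- The convexity defects of `g σ` and `g ρ`, normalized by `σ` and `ρ`, are comparable up to
positive factors. -/
theorem g_convexComb_le {ρ σ : ℝ} (hσ : -1 < σ) (hρσ : σ ≤ ρ) (hσ1 : σ ≤ 1)
    (hρ0 : ρ ≠ 0) (hσ0 : σ ≠ 0) {z z₁ z₂ l : ℝ} (hz : z ∈ Ioo (0:ℝ) 1)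
    (hz₁ : z₁ ∈ Icc (0:ℝ) 1) (hz₂ : z₂ ∈ Icc (0:ℝ) 1) (hl : l ∈ Icc (0:ℝ) 1) :
    ∃ p q : ℝ, 0 < p ∧ 0 < q ∧
      p * ((g σ z - (l * g σ z₁ + (1-l) * g σ z₂)) / σ) ≤
        q * ((g ρ z - (l * g ρ z₁ + (1-l) * g ρ z₂)) / ρ) := by
  have hρ : -1 < ρ := by linarith
  have hρ' : 0 < 1 + ρ := by linarith
  have hσ' : 0 < 1 + σ := by linarith
  have ne : ∀ {r : ℝ}, -1 < r → r ≠ 0 → 1/(1+r) ≠ 1 := by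
    intro r h h0 h1
    have := one_div_one_add_sub_one h
    rw [h1, sub_self, eq_comm, neg_eq_zero, div_eq_zero_iff] at this
    rcases this with h | h
    · exact h0 h
    · linarith
  have key := fun w (hw : w ∈ Icc (0:ℝ) 1) => powMean_tangent_le (s := 1/(1+ρ)) (t := 1/(1+σ))
    (by positivity) (one_div_le_one_div_of_le hσ' (by linarith))
    (one_div_le_one_div_of_le hσ' (by linarith)) (ne hρ hρ0) (ne hσ hσ0) hz hw
  refine ⟨meanSlope (1/(1+ρ)) z * (1+σ), meanSlope (1/(1+σ)) z * (1+ρ),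
    mul_pos (meanSlope_pos (ne hρ hρ0) hz) hσ', mul_pos (meanSlope_pos (ne hσ hσ0) hz) hρ', ?_⟩
  have k1 := mul_le_mul_of_nonneg_left (key z₁ hz₁) hl.1
  have k2 := mul_le_mul_of_nonneg_left (key z₂ hz₂) (sub_nonneg.2 hl.2)
  simp only [← g_eq, one_div_one_add_sub_one hρ, one_div_one_add_sub_one hσ] at k1 k2
  generalize meanSlope (1/(1+ρ)) z = P at *
  generalize meanSlope (1/(1+σ)) z = R at *
  have d : ∀ {r y : ℝ}, y / -(r/(1+r)) = -((1+r) * (y / r)) := by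
    intro r y
    rw [div_neg, div_div_eq_mul_div]; ring
  simp only [d] at k1 k2
  simp only [sub_div, add_div, mul_div_assoc]
  linarith

theorem g_convexComb_of_endpoint {ρ₁ ρ₂ z z₁ z₂ l : ℝ} (hρ : -1 < ρ₁) (hρ0 : ρ₁ ≠ 0)
    (hz : z = 0 ∨ z = 1) (hz₁ : z₁ ∈ Icc (0:ℝ) 1)
    (hz₂ : z₂ ∈ Icc (0:ℝ) 1) (hl : l ∈ Icc (0:ℝ) 1)
    (hg : g ρ₁ z = l * g ρ₁ z₁ + (1-l) * g ρ₁ z₂) :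
    g ρ₂ z = l * g ρ₂ z₁ + (1-l) * g ρ₂ z₂ := by
  have hρ' : 0 < 1 + ρ₁ := by linarith
  have hne : 1/(1+ρ₁) ≠ 1 := by
    rw [ne_eq, div_eq_one_iff_eq hρ'.ne']
    exact fun h => hρ0 (by linarith)
  refine eq_convexComb_of_endpoint
    (strictMonoOn_powMean (s := 1/(1+ρ₁)) (by positivity) hne) hz hz₁ hz₂ hl ?_
  simp only [← g_eq]
  rw [hg]
  ring

/-- Lemma 6: concavity/convexity of `t ↦ g(ρ₂, g(ρ₁,·)⁻¹(t))`, expressed through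
triples `z, z₁, z₂ ∈ [0,1]` with `g(ρ₁, z) = λ·g(ρ₁, z₁) + (1−λ)·g(ρ₁, z₂)`:
concave when `ρ₁ ∈ (−1,0)` and `ρ₂ ≥ 0`, or `0 < ρ₁ ≤ 1` and `ρ₂ ≥ ρ₁`, or
`ρ₁ > 1` and `ρ₂ ∈ (−1,0)`; convex when `ρ₁ > 1` and `ρ₂ ∈ (0,1]`. -/
theorem f_convexity (ρ₁ ρ₂ : ℝ)
    (z z₁ z₂ l : ℝ) (hz : z ∈ Set.Icc (0:ℝ) 1) (hz₁ : z₁ ∈ Set.Icc (0:ℝ) 1)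
    (hz₂ : z₂ ∈ Set.Icc (0:ℝ) 1) (hl : l ∈ Set.Icc (0:ℝ) 1)
    (hg : g ρ₁ z = l * g ρ₁ z₁ + (1-l) * g ρ₁ z₂) :
    (((ρ₁ ∈ Set.Ioo (-1:ℝ) 0 ∧ 0 ≤ ρ₂) ∨
      (0 < ρ₁ ∧ ρ₁ ≤ 1 ∧ ρ₁ ≤ ρ₂) ∨
      (1 < ρ₁ ∧ ρ₂ ∈ Set.Ioo (-1:ℝ) 0)) →
        l * g ρ₂ z₁ + (1-l) * g ρ₂ z₂ ≤ g ρ₂ z) ∧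
    ((1 < ρ₁ ∧ ρ₂ ∈ Set.Ioc (0:ℝ) 1) →
        g ρ₂ z ≤ l * g ρ₂ z₁ + (1-l) * g ρ₂ z₂) := by
  rcases eq_or_ne ρ₂ 0 with rfl | hρ₂
  · simp [g_zero]
  have hends : -1 < ρ₁ → ρ₁ ≠ 0 → z ∉ Ioo (0:ℝ) 1 →
      g ρ₂ z = l * g ρ₂ z₁ + (1-l) * g ρ₂ z₂ := by
    intro h h0 hz'
    refine g_convexComb_of_endpoint h h0 ?_ hz₁ hz₂ hl hg
    by_contra! hne
    exact hz' ⟨lt_of_le_of_ne hz.1 hne.1.symm, lt_of_le_of_ne hz.2 hne.2⟩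
  have concave_of_le : -1 < ρ₁ → ρ₁ ≠ 0 → ρ₁ ≤ 1 → ρ₁ ≤ ρ₂ → 0 < ρ₂ →
      l * g ρ₂ z₁ + (1-l) * g ρ₂ z₂ ≤ g ρ₂ z := by
    intro h h0 h1 h12 h2
    by_cases hz' : z ∈ Ioo (0:ℝ) 1
    · obtain ⟨p, q, _, hq, hpq⟩ := g_convexComb_le h h12 h1 hρ₂ h0 hz' hz₁ hz₂ hl
      rw [hg, sub_self, zero_div, mul_zero] at hpq
      have := nonneg_of_mul_nonneg_right hpq hq
      rw [le_div_iff₀ h2] at this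
      linarith
    · exact (hends h h0 hz').ge
  have div_nonpos_of_ge : 1 < ρ₁ → -1 < ρ₂ → ρ₂ ≤ 1 → z ∈ Ioo (0:ℝ) 1 →
      (g ρ₂ z - (l * g ρ₂ z₁ + (1-l) * g ρ₂ z₂)) / ρ₂ ≤ 0 := by
    intro h1 h2 h21 hz'
    obtain ⟨p, q, hp, _, hpq⟩ :=
      g_convexComb_le h2 (h21.trans h1.le) h21 (by linarith) hρ₂ hz' hz₁ hz₂ hl
    rw [hg, sub_self, zero_div, mul_zero] at hpq
    exact nonpos_of_mul_nonpos_right hpq hp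
  constructor
  · rintro (⟨h1, h2⟩ | ⟨h1, h1', h2⟩ | ⟨h1, h2⟩)
    · exact concave_of_le h1.1 h1.2.ne (by linarith [h1.2]) (by linarith [h1.2])
        (lt_of_le_of_ne h2 hρ₂.symm)
    · exact concave_of_le (by linarith) h1.ne' h1' h2 (by linarith)
    · by_cases hz' : z ∈ Ioo (0:ℝ) 1
      · have := div_nonpos_of_ge h1 h2.1 (by linarith [h2.2]) hz'
        rw [div_le_iff_of_neg h2.2] at this
        linarith
      · exact (hends (by linarith) (by linarith) hz').ge
  · rintro ⟨h1, h2⟩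
    by_cases hz' : z ∈ Ioo (0:ℝ) 1
    · have := div_nonpos_of_ge h1 (by linarith [h2.1]) h2.2 hz'
      rw [div_le_iff₀ h2.1] at this
      linarith
    · exact (hends (by linarith) (by linarith) hz').le
end
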